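/- arXiv:2109.14529 — 2 statements merged into one kernel-verified Lean document; each statement's English description precedes it below -/
import Mathlib

section
/- Let (v,u,χ,θ) ∈ X(0,T;m₁,m₂,m₃,N) be a solution to the initial-boundary value problem on [0,1]×[0,T], write η := χ^α and η₀ := χ₀^α. Then for every t ≥ 0 there exists α₀(t) ∈ (0,1) such that v(x,t) = B(t)D(x,t) + ∫₀^t [B(t)D(x,t)/(B(τ)D(x,τ))] v(x,τ)J(x,τ) dτ, where g(x,t) := −[u(1/η)_t + (θ/v)(1/η)_x + (χ_x²/(2v²))(1/η)_x + η_x u_x/(ηv)], B(t) := exp{−∫₀^t ∫₀¹ ((θ+u²)/η + χ_x²/(2ηv)) dx dτ}, D(x,t) := v₀(x) exp{∫_{α₀(t)}^x (u/η) dy − ∫₀^x (u₀/η₀) dy + ∫₀¹ v₀ (∫₀^x (u₀/η₀) dy) dx}, and J(x,t) := (θ/(ηv) + χ_x²/(2ηv²) + ∫₀^x g dy)(x,t) − ∫₀¹ v (∫₀^x g dy)(x,t) dx. -/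
open MeasureTheory Set

noncomputable section

/-- Partial derivative in the spatial variable `x` (second argument). -/
def pdx (f : ℝ → ℝ → ℝ) : ℝ → ℝ → ℝ := fun t x => deriv (f t) x

/-- Partial derivative in the time variable `t` (first argument). -/
def pdt (f : ℝ → ℝ → ℝ) : ℝ → ℝ → ℝ := fun t x => deriv (fun s => f s x) t

/-- Square of the `L²(0,1)` norm. -/
def L2sq (g : ℝ → ℝ) : ℝ := ∫ x in (0:ℝ)..1, (g x) ^ 2

/-- Square of the `H¹(0,1)` norm. -/
def H1sq (g : ℝ → ℝ) : ℝ := L2sq g + L2sq (deriv g)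

/-- Square of the `H²(0,1)` norm. -/
def H2sq (g : ℝ → ℝ) : ℝ := H1sq g + L2sq (deriv (deriv g))

/-- Square of the `H³(0,1)` norm. -/
def H3sq (g : ℝ → ℝ) : ℝ := H2sq g + L2sq (deriv (deriv (deriv g)))

/-- `L¹(0,1)` norm. -/
def L1norm (g : ℝ → ℝ) : ℝ := ∫ x in (0:ℝ)..1, |g x|

/-- `L^∞([0,1])` norm (for continuous functions). -/
def LinfNorm (g : ℝ → ℝ) : ℝ := sSup ((fun x => |g x|) '' Icc (0:ℝ) 1)

/-- `Φ(s) = s - log s - 1`. -/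
def Phi (s : ℝ) : ℝ := s - Real.log s - 1

/-- A (classical) strong solution of the 1D compressible Navier–Stokes/Allen–Cahn
system in Lagrangian coordinates on `[0,1] × S`, with viscosity `η(χ) = χ^α`,
heat conductivity `κ(θ) = θ^β`, the natural boundary conditions, and the
normalisation of the initial data at time `t = 0`. -/
structure NSAC (α β : ℝ) (S : Set ℝ) where
  v : ℝ → ℝ → ℝ
  u : ℝ → ℝ → ℝ
  χ : ℝ → ℝ → ℝ
  θ : ℝ → ℝ → ℝ
  μ : ℝ → ℝ → ℝ
  smooth_v : ContDiff ℝ (⊤ : ℕ∞) (fun p : ℝ × ℝ => v p.1 p.2)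
  smooth_u : ContDiff ℝ (⊤ : ℕ∞) (fun p : ℝ × ℝ => u p.1 p.2)
  smooth_χ : ContDiff ℝ (⊤ : ℕ∞) (fun p : ℝ × ℝ => χ p.1 p.2)
  smooth_θ : ContDiff ℝ (⊤ : ℕ∞) (fun p : ℝ × ℝ => θ p.1 p.2)
  vpos : ∀ t ∈ S, ∀ x ∈ Icc (0:ℝ) 1, 0 < v t x
  θpos : ∀ t ∈ S, ∀ x ∈ Icc (0:ℝ) 1, 0 < θ t x
  eq_mass : ∀ t ∈ S, ∀ x ∈ Icc (0:ℝ) 1, pdt v t x = pdx u t x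
  eq_mom : ∀ t ∈ S, ∀ x ∈ Icc (0:ℝ) 1,
      pdt u t x + pdx (fun t x => θ t x / v t x) t x
        = pdx (fun t x => (χ t x) ^ α * pdx u t x / v t x) t x
          - (1 / 2) * pdx (fun t x => (pdx χ t x) ^ 2 / (v t x) ^ 2) t x
  eq_phase : ∀ t ∈ S, ∀ x ∈ Icc (0:ℝ) 1, pdt χ t x = -(v t x * μ t x)
  eq_mu : ∀ t ∈ S, ∀ x ∈ Icc (0:ℝ) 1,
      μ t x = -(pdx (fun t x => pdx χ t x / v t x) t x) + ((χ t x) ^ 3 - χ t x)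
  eq_temp : ∀ t ∈ S, ∀ x ∈ Icc (0:ℝ) 1,
      pdt θ t x + (θ t x / v t x) * pdx u t x
        = pdx (fun t x => (θ t x) ^ β * pdx θ t x / v t x) t x
          + (χ t x) ^ α * (pdx u t x) ^ 2 / v t x + v t x * (μ t x) ^ 2
  bc_u : ∀ t ∈ S, u t 0 = 0 ∧ u t 1 = 0
  bc_χ : ∀ t ∈ S, pdx χ t 0 = 0 ∧ pdx χ t 1 = 0
  bc_θ : ∀ t ∈ S, pdx θ t 0 = 0 ∧ pdx θ t 1 = 0
  norm_v0 : (∫ x in (0:ℝ)..1, v 0 x) = 1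
  norm_e0 : (∫ x in (0:ℝ)..1,
      (θ 0 x + (u 0 x) ^ 2 / 2 + ((χ 0 x) ^ 2 - 1) ^ 2 / 4
        + (pdx χ 0 x) ^ 2 / (2 * v 0 x))) = 1

/-- Membership in the class `X(0,T; m₁, m₂, m₃, N)`. -/
structure XClass (α β T m₁ m₂ m₃ N : ℝ) extends NSAC α β (Icc 0 T) where
  m₁pos : 0 < m₁
  m₂pos : 0 < m₂
  m₃pos : 0 < m₃
  Npos : 0 < N
  lb_v : ∀ t ∈ Icc (0:ℝ) T, ∀ x ∈ Icc (0:ℝ) 1, m₁ ≤ v t x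
  lb_χ : ∀ t ∈ Icc (0:ℝ) T, ∀ x ∈ Icc (0:ℝ) 1, m₂ ≤ χ t x
  lb_θ : ∀ t ∈ Icc (0:ℝ) T, ∀ x ∈ Icc (0:ℝ) 1, m₃ ≤ θ t x
  bound_E : ∀ t ∈ Icc (0:ℝ) T,
      H1sq (fun x => pdx v t x) + H1sq (fun x => pdx u t x)
        + H1sq (fun x => pdx χ t x) + H1sq (fun x => pdx θ t x)
        + (∫ τ in (0:ℝ)..T, L2sq (fun x => pdt χ τ x)) ≤ N ^ 2

/-- The dissipation functional `W(t)`. -/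
def Wdiss {α β : ℝ} {S : Set ℝ} (sol : NSAC α β S) (t : ℝ) : ℝ :=
  ∫ x in (0:ℝ)..1,
    ((sol.θ t x) ^ β * (pdx sol.θ t x) ^ 2 / (sol.v t x * (sol.θ t x) ^ 2)
      + (sol.χ t x) ^ α * (pdx sol.u t x) ^ 2 / (sol.v t x * sol.θ t x)
      + sol.v t x * (sol.μ t x) ^ 2 / sol.θ t x)

/-- The initial energy `E₀`. -/
def E0 {α β : ℝ} {S : Set ℝ} (sol : NSAC α β S) : ℝ :=
  ∫ x in (0:ℝ)..1,
    ((sol.u 0 x) ^ 2 / 2 + ((sol.χ 0 x) ^ 2 - 1) ^ 2 / 4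
      + (pdx sol.χ 0 x) ^ 2 / (2 * sol.v 0 x) + Phi (sol.v 0 x) + Phi (sol.θ 0 x))

/-- The assumptions on the initial data, with constants `V₀`, `M₀`. -/
def InitData {α β : ℝ} {S : Set ℝ} (sol : NSAC α β S) (V₀ M₀ : ℝ) : Prop :=
  (∀ x ∈ Icc (0:ℝ) 1, V₀ ≤ sol.v 0 x) ∧
  (∀ x ∈ Icc (0:ℝ) 1, V₀ ≤ sol.χ 0 x ∧ sol.χ 0 x ≤ 1) ∧
  (∀ x ∈ Icc (0:ℝ) 1, V₀ ≤ sol.θ 0 x) ∧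
  Real.sqrt (H2sq (sol.v 0) + H2sq (sol.u 0) + H2sq (sol.θ 0))
    + Real.sqrt (H3sq (sol.χ 0)) ≤ M₀

/-- `H(m₁,m₂,m₃,N) = (1 + m₁⁻¹ + m₂⁻¹ + m₃⁻¹ + N)^8`. -/
def Hq (m₁ m₂ m₃ N : ℝ) : ℝ := (1 + m₁⁻¹ + m₂⁻¹ + m₃⁻¹ + N) ^ 8

/-- `1/η(χ) = (χ^α)⁻¹`. -/
def etaInv {α β : ℝ} {S : Set ℝ} (sol : NSAC α β S) : ℝ → ℝ → ℝ :=
  fun t x => ((sol.χ t x) ^ α)⁻¹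

/-- The auxiliary function `g` in the representation of the specific volume. -/
def gfun {α β : ℝ} {S : Set ℝ} (sol : NSAC α β S) : ℝ → ℝ → ℝ := fun t x =>
  -(sol.u t x * pdt (etaInv sol) t x
    + (sol.θ t x / sol.v t x) * pdx (etaInv sol) t x
    + ((pdx sol.χ t x) ^ 2 / (2 * (sol.v t x) ^ 2)) * pdx (etaInv sol) t x
    + pdx (fun t x => (sol.χ t x) ^ α) t x * pdx sol.u t x
        / ((sol.χ t x) ^ α * sol.v t x))

/-- The function `B(t)` in the representation of the specific volume. -/
def Bfun {α β : ℝ} {S : Set ℝ} (sol : NSAC α β S) : ℝ → ℝ := fun t =>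
  Real.exp (-(∫ τ in (0:ℝ)..t, ∫ x in (0:ℝ)..1,
    ((sol.θ τ x + (sol.u τ x) ^ 2) / (sol.χ τ x) ^ α
      + (pdx sol.χ τ x) ^ 2 / (2 * (sol.χ τ x) ^ α * sol.v τ x))))

/-- The function `D(x,t)` in the representation of the specific volume
(depending on the choice `a₀` of intermediate points). -/
def Dfun {α β : ℝ} {S : Set ℝ} (sol : NSAC α β S) (a₀ : ℝ → ℝ) : ℝ → ℝ → ℝ :=
  fun t x =>
    sol.v 0 x * Real.exp
      ((∫ y in (a₀ t)..x, sol.u t y / (sol.χ t y) ^ α)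
        - (∫ y in (0:ℝ)..x, sol.u 0 y / (sol.χ 0 y) ^ α)
        + ∫ z in (0:ℝ)..1, sol.v 0 z * ∫ y in (0:ℝ)..z, sol.u 0 y / (sol.χ 0 y) ^ α)

/-- The function `J(x,t)` in the representation of the specific volume. -/
def Jfun {α β : ℝ} {S : Set ℝ} (sol : NSAC α β S) : ℝ → ℝ → ℝ := fun t x =>
  sol.θ t x / ((sol.χ t x) ^ α * sol.v t x)
    + (pdx sol.χ t x) ^ 2 / (2 * (sol.χ t x) ^ α * (sol.v t x) ^ 2)
    + (∫ y in (0:ℝ)..x, gfun sol t y)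
    - ∫ z in (0:ℝ)..1, sol.v t z * ∫ y in (0:ℝ)..z, gfun sol t y

/-- `χ_x / v`. -/
def qxv {α β : ℝ} {S : Set ℝ} (sol : NSAC α β S) : ℝ → ℝ → ℝ :=
  fun t x => pdx sol.χ t x / sol.v t x

/-- `χ_t / v`. -/
def qtv {α β : ℝ} {S : Set ℝ} (sol : NSAC α β S) : ℝ → ℝ → ℝ :=
  fun t x => pdt sol.χ t x / sol.v t x

/-- A function continuous on a closed rectangle extends to a continuous function on the plane. -/
theorem exists_continuous_extension_rect {T : ℝ} (hT : 0 ≤ T) {F : ℝ → ℝ → ℝ}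
    (hF : ContinuousOn (fun p : ℝ × ℝ => F p.1 p.2) (Icc 0 T ×ˢ Icc 0 1)) :
    ∃ F' : ℝ → ℝ → ℝ, Continuous (fun p : ℝ × ℝ => F' p.1 p.2) ∧
      ∀ t ∈ Icc (0:ℝ) T, ∀ x ∈ Icc (0:ℝ) 1, F' t x = F t x := by
  refine ⟨fun t x => F (projIcc 0 T hT t) (projIcc (0:ℝ) 1 zero_le_one x), ?_, ?_⟩
  · refine hF.comp_continuous (f := fun p : ℝ × ℝ =>
      (((projIcc 0 T hT p.1 : ℝ), (projIcc (0:ℝ) 1 zero_le_one p.2 : ℝ)) : ℝ × ℝ)) ?_ ?_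
    · exact (continuous_subtype_val.comp (continuous_projIcc.comp continuous_fst)).prodMk
        (continuous_subtype_val.comp (continuous_projIcc.comp continuous_snd))
    · exact fun p => ⟨Subtype.prop _, Subtype.prop _⟩
  · intro t ht x hx
    simp only [projIcc_of_mem hT ht, projIcc_of_mem zero_le_one hx]

theorem continuousOn_rect_time {T : ℝ} {F : ℝ → ℝ → ℝ}
    (hF : ContinuousOn (fun p : ℝ × ℝ => F p.1 p.2) (Icc 0 T ×ˢ Icc 0 1))
    {x : ℝ} (hx : x ∈ Icc (0:ℝ) 1) : ContinuousOn (fun t => F t x) (Icc 0 T) :=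
  hF.comp (f := fun t : ℝ => (t, x)) (by fun_prop) fun _ ht => ⟨ht, hx⟩

theorem continuousOn_rect_space {T : ℝ} {F : ℝ → ℝ → ℝ}
    (hF : ContinuousOn (fun p : ℝ × ℝ => F p.1 p.2) (Icc 0 T ×ˢ Icc 0 1))
    {t : ℝ} (ht : t ∈ Icc (0:ℝ) T) : ContinuousOn (fun x => F t x) (Icc 0 1) :=
  hF.comp (f := fun x : ℝ => (t, x)) (by fun_prop) fun _ hx => ⟨ht, hx⟩

theorem continuousOn_rect_primitive_space {T : ℝ} (hT : 0 ≤ T) {F : ℝ → ℝ → ℝ}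
    (hF : ContinuousOn (fun p : ℝ × ℝ => F p.1 p.2) (Icc 0 T ×ˢ Icc 0 1)) :
    ContinuousOn (fun p : ℝ × ℝ => ∫ y in (0:ℝ)..p.2, F p.1 y) (Icc 0 T ×ˢ Icc 0 1) := by
  obtain ⟨F', hc, he⟩ := exists_continuous_extension_rect hT hF
  refine (intervalIntegral.continuous_parametric_primitive_of_continuous (μ := volume)
    (f := F') (a₀ := 0) hc).continuousOn.congr ?_
  rintro ⟨t, x⟩ ⟨ht, hx⟩
  refine intervalIntegral.integral_congr fun y hy => (he t ht y ?_).symm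
  rw [uIcc_of_le hx.1] at hy
  exact ⟨hy.1, hy.2.trans hx.2⟩

theorem continuousOn_rect_primitive_time {T : ℝ} (hT : 0 ≤ T) {F : ℝ → ℝ → ℝ}
    (hF : ContinuousOn (fun p : ℝ × ℝ => F p.1 p.2) (Icc 0 T ×ˢ Icc 0 1)) :
    ContinuousOn (fun p : ℝ × ℝ => ∫ τ in (0:ℝ)..p.1, F τ p.2) (Icc 0 T ×ˢ Icc 0 1) := by
  obtain ⟨F', hc, he⟩ := exists_continuous_extension_rect hT hF
  refine ((intervalIntegral.continuous_parametric_primitive_of_continuous (μ := volume)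
    (f := fun x t => F' t x) (a₀ := 0) (hc.comp continuous_swap)).comp
      continuous_swap).continuousOn.congr ?_
  rintro ⟨t, x⟩ ⟨ht, hx⟩
  refine intervalIntegral.integral_congr fun τ hτ => (he τ ?_ x hx).symm
  rw [uIcc_of_le ht.1] at hτ
  exact ⟨hτ.1, hτ.2.trans ht.2⟩

theorem continuousOn_integral_space {T : ℝ} (hT : 0 ≤ T) {F : ℝ → ℝ → ℝ}
    (hF : ContinuousOn (fun p : ℝ × ℝ => F p.1 p.2) (Icc 0 T ×ˢ Icc 0 1)) :
    ContinuousOn (fun t => ∫ y in (0:ℝ)..1, F t y) (Icc 0 T) :=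
  continuousOn_rect_time (F := fun t x => ∫ y in (0:ℝ)..x, F t y)
    (continuousOn_rect_primitive_space hT hF) ⟨zero_le_one, le_rfl⟩

theorem ContinuousOn.intervalIntegrable_zero {T t : ℝ} {f : ℝ → ℝ}
    (hf : ContinuousOn f (Icc 0 T)) (ht : t ∈ Icc (0:ℝ) T) : IntervalIntegrable f volume 0 t :=
  (hf.mono (Icc_subset_Icc_right ht.2)).intervalIntegrable_of_Icc ht.1

theorem hasDerivAt_primitive_of_continuousOn {T t : ℝ} {f : ℝ → ℝ}
    (hf : ContinuousOn f (Icc 0 T)) (ht : t ∈ Ioo (0:ℝ) T) :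
    HasDerivAt (fun s => ∫ τ in (0:ℝ)..s, f τ) (f t) t := by
  refine intervalIntegral.integral_hasDerivAt_right
    (hf.intervalIntegrable_zero (Ioo_subset_Icc_self ht)) ?_
    (hf.continuousAt (Icc_mem_nhds ht.1 ht.2))
  exact (hf.mono Ioo_subset_Icc_self).stronglyMeasurableAtFilter isOpen_Ioo t ht

theorem continuousOn_primitive_zero {T : ℝ} (hT : 0 ≤ T) {f : ℝ → ℝ}
    (hf : ContinuousOn f (Icc 0 T)) :
    ContinuousOn (fun s => ∫ τ in (0:ℝ)..s, f τ) (Icc 0 T) := by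
  have := intervalIntegral.continuousOn_primitive_interval
    (hf.integrableOn_Icc (μ := volume) |>.mono_set (uIcc_of_le hT).le)
  rwa [uIcc_of_le hT] at this

/-- The fundamental theorem of calculus for a function differentiable inside the interval. -/
theorem integral_eq_sub_of_continuousOn {T t : ℝ} {f f' : ℝ → ℝ} (ht : t ∈ Icc (0:ℝ) T)
    (hf : ContinuousOn f (Icc 0 T)) (hf' : ContinuousOn f' (Icc 0 T))
    (hd : ∀ s ∈ Ioo (0:ℝ) T, HasDerivAt f (f' s) s) :
    ∫ s in (0:ℝ)..t, f' s = f t - f 0 :=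
  intervalIntegral.integral_eq_sub_of_hasDerivAt_of_le ht.1
    (hf.mono (Icc_subset_Icc_right ht.2)) (fun s hs => hd s ⟨hs.1, hs.2.trans_le ht.2⟩)
    (hf'.intervalIntegrable_zero ht)

theorem integral_rect_swap {T t x : ℝ} {F : ℝ → ℝ → ℝ}
    (hF : ContinuousOn (fun p : ℝ × ℝ => F p.1 p.2) (Icc 0 T ×ˢ Icc 0 1))
    (ht : t ∈ Icc (0:ℝ) T) (hx : x ∈ Icc (0:ℝ) 1) :
    ∫ τ in (0:ℝ)..t, ∫ y in (0:ℝ)..x, F τ y = ∫ y in (0:ℝ)..x, ∫ τ in (0:ℝ)..t, F τ y := by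
  apply intervalIntegral_intervalIntegral_swap
  rw [uIoc_of_le ht.1, uIoc_of_le hx.1]
  refine (hF.integrableOn_compact (isCompact_Icc.prod isCompact_Icc)).mono_set ?_
  exact prod_mono (Ioc_subset_Icc_self.trans (Icc_subset_Icc_right ht.2))
    (Ioc_subset_Icc_self.trans (Icc_subset_Icc_right hx.2))

/-- Weighted mean value property with an interior point. -/
theorem exists_eq_weighted_mean {w f : ℝ → ℝ} (hw : ContinuousOn w (Icc 0 1))
    (hf : ContinuousOn f (Icc 0 1)) (hpos : ∀ x ∈ Icc (0:ℝ) 1, 0 < w x)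
    (hone : ∫ x in (0:ℝ)..1, w x = 1) :
    ∃ a ∈ Ioo (0:ℝ) 1, f a = ∫ x in (0:ℝ)..1, w x * f x := by
  set M := ∫ x in (0:ℝ)..1, w x * f x with hM
  have hc : ContinuousOn (fun x => w x * f x - M * w x) (Icc 0 1) := by fun_prop
  have h1 : (1:ℝ) ∈ Icc (0:ℝ) 1 := ⟨zero_le_one, le_rfl⟩
  obtain ⟨a, ha, h⟩ := exists_hasDerivAt_eq_zero
    (f := fun s => ∫ x in (0:ℝ)..s, (w x * f x - M * w x)) zero_lt_one
    (continuousOn_primitive_zero zero_le_one hc)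
    (by
      simp only [intervalIntegral.integral_same]
      rw [intervalIntegral.integral_sub
        (ContinuousOn.intervalIntegrable_zero (by fun_prop) h1)
        (ContinuousOn.intervalIntegrable_zero (by fun_prop) h1), intervalIntegral.integral_const_mul, hone]
      simp [← hM])
    (fun x hx => hasDerivAt_primitive_of_continuousOn hc hx)
  refine ⟨a, ha, ?_⟩
  have := (hpos a (Ioo_subset_Icc_self ha)).ne'
  apply mul_left_cancel₀ this
  linarith

/-- The spatial primitive of `w` evolves by the flux `s` when `w_t = s_x - g`. -/
theorem integral_space_sub_eq_integral_flux {T : ℝ} (hT : 0 ≤ T) {w s sx g : ℝ → ℝ → ℝ}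
    (cw : ContinuousOn (fun p : ℝ × ℝ => w p.1 p.2) (Icc 0 T ×ˢ Icc 0 1))
    (cs : ContinuousOn (fun p : ℝ × ℝ => s p.1 p.2) (Icc 0 T ×ˢ Icc 0 1))
    (csx : ContinuousOn (fun p : ℝ × ℝ => sx p.1 p.2) (Icc 0 T ×ˢ Icc 0 1))
    (cg : ContinuousOn (fun p : ℝ × ℝ => g p.1 p.2) (Icc 0 T ×ˢ Icc 0 1))
    (hw : ∀ t ∈ Icc 0 T, ∀ x ∈ Icc (0:ℝ) 1, HasDerivAt (fun τ => w τ x) (sx t x - g t x) t)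
    (hs : ∀ t ∈ Icc 0 T, ∀ x ∈ Icc (0:ℝ) 1, HasDerivAt (s t) (sx t x) x)
    {t x : ℝ} (ht : t ∈ Icc 0 T) (hx : x ∈ Icc (0:ℝ) 1) :
    (∫ y in (0:ℝ)..x, w t y) - ∫ y in (0:ℝ)..x, w 0 y
      = ∫ τ in (0:ℝ)..t, (s τ x - s τ 0 - ∫ y in (0:ℝ)..x, g τ y) := by
  have h0 : (0:ℝ) ∈ Icc 0 T := ⟨le_rfl, hT⟩
  have cd : ContinuousOn (fun p : ℝ × ℝ => sx p.1 p.2 - g p.1 p.2) (Icc 0 T ×ˢ Icc 0 1) :=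
    csx.sub cg
  rw [← intervalIntegral.integral_sub ((continuousOn_rect_space cw ht).intervalIntegrable_zero hx)
    ((continuousOn_rect_space cw h0).intervalIntegrable_zero hx)]
  have h1 : ∫ y in (0:ℝ)..x, (w t y - w 0 y)
      = ∫ y in (0:ℝ)..x, ∫ τ in (0:ℝ)..t, (sx τ y - g τ y) := by
    refine intervalIntegral.integral_congr fun y hy => ?_
    rw [uIcc_of_le hx.1] at hy
    have hy' : y ∈ Icc (0:ℝ) 1 := ⟨hy.1, hy.2.trans hx.2⟩
    exact (integral_eq_sub_of_continuousOn ht (continuousOn_rect_time cw hy')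
      (continuousOn_rect_time (F := fun t x => sx t x - g t x) cd hy')
      fun τ hτ => hw τ (Ioo_subset_Icc_self hτ) y hy').symm
  rw [h1, ← integral_rect_swap (F := fun t x => sx t x - g t x) cd ht hx]
  refine intervalIntegral.integral_congr fun τ hτ => ?_
  rw [uIcc_of_le ht.1] at hτ
  have hτ' : τ ∈ Icc (0:ℝ) T := ⟨hτ.1, hτ.2.trans ht.2⟩
  rw [intervalIntegral.integral_sub ((continuousOn_rect_space csx hτ').intervalIntegrable_zero hx)
    ((continuousOn_rect_space cg hτ').intervalIntegrable_zero hx),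
    integral_eq_sub_of_continuousOn hx (continuousOn_rect_space cs hτ')
      (continuousOn_rect_space csx hτ')
      fun y hy => hs τ hτ' y (Ioo_subset_Icc_self hy)]

/-- Evolution of the spatial mean of a product `v φ` with `v_t = u_x`, `φ_t = k`, `φ_x = w`. -/
theorem integral_mul_sub_eq {T : ℝ} (hT : 0 ≤ T) {v u ux φ k w : ℝ → ℝ → ℝ}
    (cv : ContinuousOn (fun p : ℝ × ℝ => v p.1 p.2) (Icc 0 T ×ˢ Icc 0 1))
    (cu : ContinuousOn (fun p : ℝ × ℝ => u p.1 p.2) (Icc 0 T ×ˢ Icc 0 1))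
    (cux : ContinuousOn (fun p : ℝ × ℝ => ux p.1 p.2) (Icc 0 T ×ˢ Icc 0 1))
    (cφ : ContinuousOn (fun p : ℝ × ℝ => φ p.1 p.2) (Icc 0 T ×ˢ Icc 0 1))
    (ck : ContinuousOn (fun p : ℝ × ℝ => k p.1 p.2) (Icc 0 T ×ˢ Icc 0 1))
    (cw : ContinuousOn (fun p : ℝ × ℝ => w p.1 p.2) (Icc 0 T ×ˢ Icc 0 1))
    (hv : ∀ t ∈ Icc 0 T, ∀ x ∈ Icc (0:ℝ) 1, HasDerivAt (fun τ => v τ x) (ux t x) t)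
    (hu : ∀ t ∈ Icc 0 T, ∀ x ∈ Icc (0:ℝ) 1, HasDerivAt (u t) (ux t x) x)
    (hφt : ∀ t ∈ Ioo 0 T, ∀ x ∈ Icc (0:ℝ) 1, HasDerivAt (fun τ => φ τ x) (k t x) t)
    (hφx : ∀ t ∈ Icc 0 T, ∀ x ∈ Ioo (0:ℝ) 1, HasDerivAt (φ t) (w t x) x)
    (hb : ∀ t ∈ Icc 0 T, u t 0 = 0 ∧ u t 1 = 0)
    {t : ℝ} (ht : t ∈ Icc 0 T) :
    (∫ x in (0:ℝ)..1, v t x * φ t x) - ∫ x in (0:ℝ)..1, v 0 x * φ 0 x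
      = ∫ τ in (0:ℝ)..t, ∫ x in (0:ℝ)..1, (v τ x * k τ x - u τ x * w τ x) := by
  have h0 : (0:ℝ) ∈ Icc 0 T := ⟨le_rfl, hT⟩
  have h1 : (1:ℝ) ∈ Icc (0:ℝ) 1 := ⟨zero_le_one, le_rfl⟩
  have cvφ : ContinuousOn (fun p : ℝ × ℝ => v p.1 p.2 * φ p.1 p.2) (Icc 0 T ×ˢ Icc 0 1) :=
    cv.mul cφ
  have cd : ContinuousOn (fun p : ℝ × ℝ => ux p.1 p.2 * φ p.1 p.2 + v p.1 p.2 * k p.1 p.2)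
      (Icc 0 T ×ˢ Icc 0 1) := (cux.mul cφ).add (cv.mul ck)
  have cp : ContinuousOn (fun p : ℝ × ℝ => ux p.1 p.2 * φ p.1 p.2 + u p.1 p.2 * w p.1 p.2)
      (Icc 0 T ×ˢ Icc 0 1) := (cux.mul cφ).add (cu.mul cw)
  have cq : ContinuousOn (fun p : ℝ × ℝ => v p.1 p.2 * k p.1 p.2 - u p.1 p.2 * w p.1 p.2)
      (Icc 0 T ×ˢ Icc 0 1) := (cv.mul ck).sub (cu.mul cw)
  rw [← intervalIntegral.integral_sub
    ((continuousOn_rect_space (F := fun t x => v t x * φ t x) cvφ ht).intervalIntegrable_zero h1)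
    ((continuousOn_rect_space (F := fun t x => v t x * φ t x) cvφ h0).intervalIntegrable_zero h1)]
  have hA : ∫ x in (0:ℝ)..1, (v t x * φ t x - v 0 x * φ 0 x)
      = ∫ x in (0:ℝ)..1, ∫ τ in (0:ℝ)..t, (ux τ x * φ τ x + v τ x * k τ x) := by
    refine intervalIntegral.integral_congr fun x hx => ?_
    rw [uIcc_of_le zero_le_one] at hx
    exact (integral_eq_sub_of_continuousOn ht
      (continuousOn_rect_time (F := fun t x => v t x * φ t x) cvφ hx)
      (continuousOn_rect_time (F := fun t x => ux t x * φ t x + v t x * k t x) cd hx)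
      fun τ hτ => (hv τ (Ioo_subset_Icc_self hτ) x hx).mul (hφt τ hτ x hx)).symm
  rw [hA, ← integral_rect_swap (F := fun t x => ux t x * φ t x + v t x * k t x) cd ht h1]
  refine intervalIntegral.integral_congr fun τ hτ => ?_
  rw [uIcc_of_le ht.1] at hτ
  have hτ' : τ ∈ Icc (0:ℝ) T := ⟨hτ.1, hτ.2.trans ht.2⟩
  have hparts : ∫ x in (0:ℝ)..1, (ux τ x * φ τ x + u τ x * w τ x) = 0 := by
    rw [integral_eq_sub_of_continuousOn (f := fun x => u τ x * φ τ x) h1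
      ((continuousOn_rect_space cu hτ').mul (continuousOn_rect_space cφ hτ'))
      (continuousOn_rect_space (F := fun t x => ux t x * φ t x + u t x * w t x) cp hτ')
      fun x hx => (hu τ hτ' x (Ioo_subset_Icc_self hx)).mul (hφx τ hτ' x hx)]
    simp [hb τ hτ']
  rw [← sub_eq_zero, ← intervalIntegral.integral_sub
    ((continuousOn_rect_space (F := fun t x => ux t x * φ t x + v t x * k t x) cd
      hτ').intervalIntegrable_zero h1)
    ((continuousOn_rect_space (F := fun t x => v t x * k t x - u t x * w t x) cq
      hτ').intervalIntegrable_zero h1)]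
  refine Eq.trans (intervalIntegral.integral_congr fun x _ => ?_) hparts
  ring

/-- If `z = A exp(∫ J)` then `z` solves the linear Volterra representation formula. -/
theorem eq_add_integral_of_eq_mul_exp {T : ℝ} (hT : 0 ≤ T) {z A J : ℝ → ℝ}
    (cJ : ContinuousOn J (Icc 0 T)) (hA : ∀ t ∈ Icc 0 T, A t ≠ 0)
    (hz : ∀ t ∈ Icc 0 T, z t = A t * Real.exp (∫ τ in (0:ℝ)..t, J τ))
    {t : ℝ} (ht : t ∈ Icc 0 T) :
    z t = A t + ∫ τ in (0:ℝ)..t, A t / A τ * (z τ * J τ) := by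
  have cE := continuousOn_primitive_zero hT cJ
  have h1 : ∫ τ in (0:ℝ)..t, A t / A τ * (z τ * J τ)
      = ∫ τ in (0:ℝ)..t, A t * (Real.exp (∫ r in (0:ℝ)..τ, J r) * J τ) := by
    refine intervalIntegral.integral_congr fun τ hτ => ?_
    rw [uIcc_of_le ht.1] at hτ
    have hτ' : τ ∈ Icc (0:ℝ) T := ⟨hτ.1, hτ.2.trans ht.2⟩
    have := hA τ hτ'
    simp only [hz τ hτ']
    field_simp
  rw [h1, intervalIntegral.integral_const_mul,
    integral_eq_sub_of_continuousOn (f := fun τ => Real.exp (∫ r in (0:ℝ)..τ, J r)) ht cE.rexp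
      (f' := fun τ => Real.exp (∫ r in (0:ℝ)..τ, J r) * J τ) (cE.rexp.mul cJ)
      fun τ hτ => (hasDerivAt_primitive_of_continuousOn cJ hτ).exp, hz t ht]
  simp
  ring

/-- Representation of the specific volume from the abstract balance laws
`v_t = u_x`, `w_t = s_x - g` with `s = u_x / v - P`. -/
theorem exists_volume_representation {T : ℝ} (hT : 0 ≤ T) {v u ux w s sx g P : ℝ → ℝ → ℝ}
    (cv : ContinuousOn (fun p : ℝ × ℝ => v p.1 p.2) (Icc 0 T ×ˢ Icc 0 1))
    (cu : ContinuousOn (fun p : ℝ × ℝ => u p.1 p.2) (Icc 0 T ×ˢ Icc 0 1))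
    (cux : ContinuousOn (fun p : ℝ × ℝ => ux p.1 p.2) (Icc 0 T ×ˢ Icc 0 1))
    (cw : ContinuousOn (fun p : ℝ × ℝ => w p.1 p.2) (Icc 0 T ×ˢ Icc 0 1))
    (cs : ContinuousOn (fun p : ℝ × ℝ => s p.1 p.2) (Icc 0 T ×ˢ Icc 0 1))
    (csx : ContinuousOn (fun p : ℝ × ℝ => sx p.1 p.2) (Icc 0 T ×ˢ Icc 0 1))
    (cg : ContinuousOn (fun p : ℝ × ℝ => g p.1 p.2) (Icc 0 T ×ˢ Icc 0 1))
    (cP : ContinuousOn (fun p : ℝ × ℝ => P p.1 p.2) (Icc 0 T ×ˢ Icc 0 1))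
    (hpos : ∀ t ∈ Icc 0 T, ∀ x ∈ Icc (0:ℝ) 1, 0 < v t x)
    (hv : ∀ t ∈ Icc 0 T, ∀ x ∈ Icc (0:ℝ) 1, HasDerivAt (fun τ => v τ x) (ux t x) t)
    (hu : ∀ t ∈ Icc 0 T, ∀ x ∈ Icc (0:ℝ) 1, HasDerivAt (u t) (ux t x) x)
    (hw : ∀ t ∈ Icc 0 T, ∀ x ∈ Icc (0:ℝ) 1, HasDerivAt (fun τ => w τ x) (sx t x - g t x) t)
    (hs : ∀ t ∈ Icc 0 T, ∀ x ∈ Icc (0:ℝ) 1, HasDerivAt (s t) (sx t x) x)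
    (hsP : ∀ t ∈ Icc 0 T, ∀ x ∈ Icc (0:ℝ) 1, s t x = ux t x / v t x - P t x)
    (hb : ∀ t ∈ Icc 0 T, u t 0 = 0 ∧ u t 1 = 0)
    (hone : ∫ x in (0:ℝ)..1, v 0 x = 1) :
    ∃ a₀ : ℝ → ℝ, (∀ t ∈ Icc (0:ℝ) T, a₀ t ∈ Ioo (0:ℝ) 1) ∧
      ∀ t ∈ Icc (0:ℝ) T, ∀ x ∈ Icc (0:ℝ) 1,
        v t x = Real.exp (-∫ τ in (0:ℝ)..t, ∫ z in (0:ℝ)..1, (v τ z * P τ z + u τ z * w τ z))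
          * (v 0 x * Real.exp ((∫ y in (a₀ t)..x, w t y) - (∫ y in (0:ℝ)..x, w 0 y)
              + ∫ z in (0:ℝ)..1, v 0 z * ∫ y in (0:ℝ)..z, w 0 y))
          * Real.exp (∫ τ in (0:ℝ)..t, (P τ x + (∫ y in (0:ℝ)..x, g τ y)
              - ∫ z in (0:ℝ)..1, v τ z * ∫ y in (0:ℝ)..z, g τ y)) := by
  have h0 : (0:ℝ) ∈ Icc 0 T := ⟨le_rfl, hT⟩
  have h0' : (0:ℝ) ∈ Icc (0:ℝ) 1 := ⟨le_rfl, zero_le_one⟩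
  have h1 : (1:ℝ) ∈ Icc (0:ℝ) 1 := ⟨zero_le_one, le_rfl⟩
  set G : ℝ → ℝ → ℝ := fun t x => ∫ y in (0:ℝ)..x, g t y with hG
  have cG : ContinuousOn (fun p : ℝ × ℝ => G p.1 p.2) (Icc 0 T ×ˢ Icc 0 1) :=
    continuousOn_rect_primitive_space hT cg
  set k : ℝ → ℝ → ℝ := fun t x => s t x - G t x with hk
  have ck : ContinuousOn (fun p : ℝ × ℝ => k p.1 p.2) (Icc 0 T ×ˢ Icc 0 1) := cs.sub cG
  set φ : ℝ → ℝ → ℝ := fun t x => (∫ y in (0:ℝ)..x, w 0 y) + ∫ τ in (0:ℝ)..t, k τ x with hφ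
  have cw0 := continuousOn_rect_space cw h0
  have cφ : ContinuousOn (fun p : ℝ × ℝ => φ p.1 p.2) (Icc 0 T ×ˢ Icc 0 1) :=
    ((continuousOn_primitive_zero zero_le_one cw0).comp continuousOn_snd fun p hp => hp.2).add
      (continuousOn_rect_primitive_time hT ck)
  have hφw : ∀ t ∈ Icc 0 T, ∀ x ∈ Icc (0:ℝ) 1,
      φ t x = (∫ y in (0:ℝ)..x, w t y) + ∫ τ in (0:ℝ)..t, s τ 0 := by
    intro t ht x hx
    have e := integral_space_sub_eq_integral_flux hT cw cs csx cg hw hs ht hx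
    have e2 : ∫ τ in (0:ℝ)..t, (s τ x - s τ 0 - ∫ y in (0:ℝ)..x, g τ y)
        = (∫ τ in (0:ℝ)..t, k τ x) - ∫ τ in (0:ℝ)..t, s τ 0 := by
      rw [← intervalIntegral.integral_sub
        ((continuousOn_rect_time ck hx).intervalIntegrable_zero ht)
        ((continuousOn_rect_time cs h0').intervalIntegrable_zero ht)]
      refine intervalIntegral.integral_congr fun τ _ => ?_
      simp only [hk, hG]
      ring
    simp only [hφ]
    linarith
  have hφt : ∀ t ∈ Ioo 0 T, ∀ x ∈ Icc (0:ℝ) 1, HasDerivAt (fun τ => φ τ x) (k t x) t :=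
    fun t ht x hx =>
      (hasDerivAt_primitive_of_continuousOn (continuousOn_rect_time ck hx) ht).const_add _
  have hφx : ∀ t ∈ Icc 0 T, ∀ x ∈ Ioo (0:ℝ) 1, HasDerivAt (φ t) (w t x) x := by
    intro t ht x hx
    refine ((hasDerivAt_primitive_of_continuousOn (continuousOn_rect_space cw ht) hx).add_const
      (∫ τ in (0:ℝ)..t, s τ 0)).congr_of_eventuallyEq ?_
    filter_upwards [Icc_mem_nhds hx.1 hx.2] with y hy using hφw t ht y hy
  have hmass : ∀ t ∈ Icc 0 T, ∫ x in (0:ℝ)..1, v t x = 1 := by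
    intro t ht
    have := integral_mul_sub_eq (φ := fun _ _ => 1) (k := fun _ _ => 0) (w := fun _ _ => 0)
      hT cv cu cux continuousOn_const continuousOn_const continuousOn_const hv hu
      (fun t _ _ _ => hasDerivAt_const t 1) (fun _ _ x _ => hasDerivAt_const x 1) hb ht
    simp only [mul_one, mul_zero, sub_zero, intervalIntegral.integral_zero, hone] at this
    linarith
  have hmean : ∀ t ∈ Icc 0 T, ∃ a ∈ Ioo (0:ℝ) 1, φ t a = ∫ x in (0:ℝ)..1, v t x * φ t x :=
    fun t ht => exists_eq_weighted_mean (continuousOn_rect_space cv ht)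
      (continuousOn_rect_space cφ ht) (hpos t ht) (hmass t ht)
  choose! a₀ ha₀ hφa using hmean
  refine ⟨a₀, ha₀, fun t ht x hx => ?_⟩
  have cvG : ContinuousOn (fun p : ℝ × ℝ => v p.1 p.2 * G p.1 p.2) (Icc 0 T ×ˢ Icc 0 1) :=
    cv.mul cG
  have cvP : ContinuousOn (fun p : ℝ × ℝ => v p.1 p.2 * P p.1 p.2 + u p.1 p.2 * w p.1 p.2)
    (Icc 0 T ×ˢ Icc 0 1) := (cv.mul cP).add (cu.mul cw)
  have hM := integral_mul_sub_eq hT cv cu cux cφ ck cw hv hu hφt hφx hb ht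
  have hM0 : ∫ z in (0:ℝ)..1, v 0 z * φ 0 z
      = ∫ z in (0:ℝ)..1, v 0 z * ∫ y in (0:ℝ)..z, w 0 y := by simp [hφ]
  have hMr : ∫ τ in (0:ℝ)..t, ∫ z in (0:ℝ)..1, (v τ z * k τ z - u τ z * w τ z)
      = -(∫ τ in (0:ℝ)..t, ∫ z in (0:ℝ)..1, (v τ z * P τ z + u τ z * w τ z))
        - ∫ τ in (0:ℝ)..t, ∫ z in (0:ℝ)..1, v τ z * G τ z := by
    rw [← intervalIntegral.integral_neg, ← intervalIntegral.integral_sub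
      (f := fun τ => -∫ z in (0:ℝ)..1, (v τ z * P τ z + u τ z * w τ z))
      ((continuousOn_integral_space hT (F := fun t x => v t x * P t x + u t x * w t x)
        cvP).intervalIntegrable_zero ht).neg
      ((continuousOn_integral_space hT (F := fun t x => v t x * G t x)
        cvG).intervalIntegrable_zero ht)]
    refine intervalIntegral.integral_congr fun τ hτ => ?_
    rw [uIcc_of_le ht.1] at hτ
    have hτ' : τ ∈ Icc (0:ℝ) T := ⟨hτ.1, hτ.2.trans ht.2⟩
    have hux : ∫ z in (0:ℝ)..1, ux τ z = 0 := by
      rw [integral_eq_sub_of_continuousOn h1 (continuousOn_rect_space cu hτ')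
        (continuousOn_rect_space cux hτ') fun z hz => hu τ hτ' z (Ioo_subset_Icc_self hz)]
      simp [hb τ hτ']
    have iP := (continuousOn_rect_space (F := fun t x => v t x * P t x + u t x * w t x) cvP
      hτ').intervalIntegrable_zero h1
    have iG := (continuousOn_rect_space (F := fun t x => v t x * G t x) cvG
      hτ').intervalIntegrable_zero h1
    have iu := (continuousOn_rect_space cux hτ').intervalIntegrable_zero h1
    have hsum := intervalIntegral.integral_sub
      (f := fun z => ux τ z - (v τ z * P τ z + u τ z * w τ z)) (iu.sub iP) iG
    rw [intervalIntegral.integral_sub iu iP, hux, zero_sub] at hsum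
    refine Eq.trans ?_ hsum
    refine intervalIntegral.integral_congr fun z hz => ?_
    rw [uIcc_of_le zero_le_one] at hz
    have := (hpos τ hτ' z hz).ne'
    simp only [hk, hsP τ hτ' z hz]
    field_simp
    ring
  have hax : φ t x - φ t (a₀ t) = ∫ y in (a₀ t)..x, w t y := by
    have ha := Ioo_subset_Icc_self (ha₀ t ht)
    have cwt := continuousOn_rect_space cw ht
    rw [hφw t ht x hx, hφw t ht _ ha, ← intervalIntegral.integral_interval_sub_left
      (cwt.intervalIntegrable_zero hx) (cwt.intervalIntegrable_zero ha)]
    ring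
  have hlog : Real.log (v t x) - Real.log (v 0 x) = ∫ τ in (0:ℝ)..t, (k τ x + (P τ x + G τ x)) := by
    have cvx := continuousOn_rect_time cv hx
    have cux' := continuousOn_rect_time cux hx
    rw [← integral_eq_sub_of_continuousOn (f := fun τ => Real.log (v τ x))
      (f' := fun τ => ux τ x / v τ x) ht
      (cvx.log fun τ hτ => (hpos τ hτ x hx).ne')
      (cux'.div cvx fun τ hτ => (hpos τ hτ x hx).ne')
      fun τ hτ => (hv τ (Ioo_subset_Icc_self hτ) x hx).log
        (hpos τ (Ioo_subset_Icc_self hτ) x hx).ne']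
    refine intervalIntegral.integral_congr fun τ hτ => ?_
    rw [uIcc_of_le ht.1] at hτ
    simp only [hk, hsP τ ⟨hτ.1, hτ.2.trans ht.2⟩ x hx]
    ring
  have cPG : ContinuousOn (fun τ => P τ x + G τ x) (Icc 0 T) :=
    (continuousOn_rect_time cP hx).add (continuousOn_rect_time cG hx)
  rw [intervalIntegral.integral_add ((continuousOn_rect_time ck hx).intervalIntegrable_zero ht)
    (cPG.intervalIntegrable_zero ht)] at hlog
  have hJ : ∫ τ in (0:ℝ)..t, (P τ x + G τ x - ∫ z in (0:ℝ)..1, v τ z * G τ z)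
      = (∫ τ in (0:ℝ)..t, (P τ x + G τ x)) - ∫ τ in (0:ℝ)..t, ∫ z in (0:ℝ)..1, v τ z * G τ z :=
    intervalIntegral.integral_sub (cPG.intervalIntegrable_zero ht)
      ((continuousOn_integral_space hT (F := fun t x => v t x * G t x)
        cvG).intervalIntegrable_zero ht)
  have hφtx : φ t x = (∫ y in (0:ℝ)..x, w 0 y) + ∫ τ in (0:ℝ)..t, k τ x := rfl
  have hφat := hφa t ht
  rw [hJ, ← Real.exp_log (hpos t ht x hx)]
  nth_rewrite 1 [← Real.exp_log (hpos 0 h0 x hx)]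
  rw [← Real.exp_add, ← Real.exp_add, ← Real.exp_add]
  congr 1
  linarith

theorem pdx_eq_fderiv {f : ℝ → ℝ → ℝ} {t x : ℝ}
    (hf : DifferentiableAt ℝ (fun p : ℝ × ℝ => f p.1 p.2) (t, x)) :
    pdx f t x = fderiv ℝ (fun p : ℝ × ℝ => f p.1 p.2) (t, x) (0, 1) :=
  (hf.hasFDerivAt.comp_hasDerivAt x ((hasDerivAt_const x t).prodMk (hasDerivAt_id x))).deriv

theorem pdt_eq_fderiv {f : ℝ → ℝ → ℝ} {t x : ℝ}
    (hf : DifferentiableAt ℝ (fun p : ℝ × ℝ => f p.1 p.2) (t, x)) :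
    pdt f t x = fderiv ℝ (fun p : ℝ × ℝ => f p.1 p.2) (t, x) (1, 0) :=
  (hf.hasFDerivAt.comp_hasDerivAt (f := fun s : ℝ => (s, x)) t
    ((hasDerivAt_id t).prodMk (hasDerivAt_const t x))).deriv

theorem ContDiffAt.eventually_differentiableAt {E : Type*} [NormedAddCommGroup E]
    [NormedSpace ℝ E] {f : E → ℝ} {p : E} (hf : ContDiffAt ℝ (⊤ : ℕ∞) f p) :
    ∀ᶠ q in nhds p, DifferentiableAt ℝ f q := by
  have h1 : ContDiffAt ℝ 1 f p := hf.of_le (by exact_mod_cast le_top)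
  filter_upwards [h1.eventually (by simp)] with q hq
  exact hq.differentiableAt one_ne_zero

theorem ContDiffAt.hasDerivAt_pdx {f : ℝ → ℝ → ℝ} {t x : ℝ}
    (hf : ContDiffAt ℝ (⊤ : ℕ∞) (fun p : ℝ × ℝ => f p.1 p.2) (t, x)) :
    HasDerivAt (f t) (_root_.pdx f t x) x :=
  (hf.eventually_differentiableAt.self_of_nhds.comp x (f := fun y : ℝ => (t, y))
    (by fun_prop)).hasDerivAt

theorem ContDiffAt.hasDerivAt_pdt {f : ℝ → ℝ → ℝ} {t x : ℝ}
    (hf : ContDiffAt ℝ (⊤ : ℕ∞) (fun p : ℝ × ℝ => f p.1 p.2) (t, x)) :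
    HasDerivAt (fun s => f s x) (_root_.pdt f t x) t :=
  (hf.eventually_differentiableAt.self_of_nhds.comp t (f := fun s : ℝ => (s, x))
    (by fun_prop)).hasDerivAt

theorem ContDiffAt.pdx {f : ℝ → ℝ → ℝ} {p : ℝ × ℝ}
    (hf : ContDiffAt ℝ (⊤ : ℕ∞) (fun p : ℝ × ℝ => f p.1 p.2) p) :
    ContDiffAt ℝ (⊤ : ℕ∞) (fun p : ℝ × ℝ => pdx f p.1 p.2) p := by
  refine ((hf.fderiv_right (m := (⊤ : ℕ∞)) (by simp)).clm_apply
    (contDiffAt_const (c := ((0:ℝ), (1:ℝ))))).congr_of_eventuallyEq ?_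
  filter_upwards [hf.eventually_differentiableAt] with q hq using pdx_eq_fderiv hq

theorem ContDiffAt.pdt {f : ℝ → ℝ → ℝ} {p : ℝ × ℝ}
    (hf : ContDiffAt ℝ (⊤ : ℕ∞) (fun p : ℝ × ℝ => f p.1 p.2) p) :
    ContDiffAt ℝ (⊤ : ℕ∞) (fun p : ℝ × ℝ => pdt f p.1 p.2) p := by
  refine ((hf.fderiv_right (m := (⊤ : ℕ∞)) (by simp)).clm_apply
    (contDiffAt_const (c := ((1:ℝ), (0:ℝ))))).congr_of_eventuallyEq ?_
  filter_upwards [hf.eventually_differentiableAt] with q hq using pdt_eq_fderiv hq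

/-- The effective viscous flux divided by the viscosity. -/
def fluxEta {α β : ℝ} {S : Set ℝ} (sol : NSAC α β S) : ℝ → ℝ → ℝ := fun t x =>
  ((sol.χ t x) ^ α * pdx sol.u t x / sol.v t x - sol.θ t x / sol.v t x
    - 1 / 2 * ((pdx sol.χ t x) ^ 2 / (sol.v t x) ^ 2)) * etaInv sol t x

section Smoothness

variable {α β : ℝ} {S : Set ℝ} (sol : NSAC α β S) {t x : ℝ}

theorem NSAC.contDiffAt_eta (hχ : 0 < sol.χ t x) :
    ContDiffAt ℝ (⊤ : ℕ∞) (fun p : ℝ × ℝ => (sol.χ p.1 p.2) ^ α) (t, x) :=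
  sol.smooth_χ.contDiffAt.rpow_const_of_ne hχ.ne'

theorem NSAC.contDiffAt_etaInv (hχ : 0 < sol.χ t x) :
    ContDiffAt ℝ (⊤ : ℕ∞) (fun p : ℝ × ℝ => etaInv sol p.1 p.2) (t, x) :=
  (sol.contDiffAt_eta hχ).inv (Real.rpow_pos_of_pos hχ α).ne'

theorem NSAC.contDiffAt_viscous (hv : 0 < sol.v t x) (hχ : 0 < sol.χ t x) :
    ContDiffAt ℝ (⊤ : ℕ∞)
      (fun p : ℝ × ℝ => (sol.χ p.1 p.2) ^ α * pdx sol.u p.1 p.2 / sol.v p.1 p.2) (t, x) :=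
  ((sol.contDiffAt_eta hχ).mul sol.smooth_u.contDiffAt.pdx).div sol.smooth_v.contDiffAt hv.ne'

theorem NSAC.contDiffAt_pressure (hv : 0 < sol.v t x) :
    ContDiffAt ℝ (⊤ : ℕ∞) (fun p : ℝ × ℝ => sol.θ p.1 p.2 / sol.v p.1 p.2) (t, x) :=
  sol.smooth_θ.contDiffAt.div sol.smooth_v.contDiffAt hv.ne'

theorem NSAC.contDiffAt_capillary (hv : 0 < sol.v t x) :
    ContDiffAt ℝ (⊤ : ℕ∞)
      (fun p : ℝ × ℝ => (pdx sol.χ p.1 p.2) ^ 2 / (sol.v p.1 p.2) ^ 2) (t, x) :=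
  (sol.smooth_χ.contDiffAt.pdx.pow 2).div (sol.smooth_v.contDiffAt.pow 2) (pow_pos hv 2).ne'

theorem NSAC.contDiffAt_fluxEta (hv : 0 < sol.v t x) (hχ : 0 < sol.χ t x) :
    ContDiffAt ℝ (⊤ : ℕ∞) (fun p : ℝ × ℝ => fluxEta sol p.1 p.2) (t, x) :=
  (((sol.contDiffAt_viscous hv hχ).sub (sol.contDiffAt_pressure hv)).sub
    (contDiffAt_const.mul (sol.contDiffAt_capillary hv))).mul (sol.contDiffAt_etaInv hχ)

theorem NSAC.contDiffAt_velocity_div_eta (hχ : 0 < sol.χ t x) :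
    ContDiffAt ℝ (⊤ : ℕ∞) (fun p : ℝ × ℝ => sol.u p.1 p.2 / (sol.χ p.1 p.2) ^ α) (t, x) :=
  sol.smooth_u.contDiffAt.div (sol.contDiffAt_eta hχ) (Real.rpow_pos_of_pos hχ α).ne'

theorem NSAC.contDiffAt_gfun (hv : 0 < sol.v t x) (hχ : 0 < sol.χ t x) :
    ContDiffAt ℝ (⊤ : ℕ∞) (fun p : ℝ × ℝ => gfun sol p.1 p.2) (t, x) := by
  have hη := Real.rpow_pos_of_pos hχ α
  have hE := sol.contDiffAt_etaInv hχ
  have hV := sol.smooth_v.contDiffAt (x := (t, x))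
  refine ContDiffAt.neg (((ContDiffAt.add ?_ ?_).add ?_).add ?_)
  · exact sol.smooth_u.contDiffAt.mul hE.pdt
  · exact (sol.contDiffAt_pressure hv).mul hE.pdx
  · exact ((sol.smooth_χ.contDiffAt.pdx.pow 2).div (contDiffAt_const.mul (hV.pow 2))
      (by positivity)).mul hE.pdx
  · exact ((ContDiffAt.pdx (f := fun t x => (sol.χ t x) ^ α) (sol.contDiffAt_eta hχ)).mul
      sol.smooth_u.contDiffAt.pdx).div ((sol.contDiffAt_eta hχ).mul hV) (by positivity)

theorem NSAC.contDiffAt_scaled_stress (hv : 0 < sol.v t x) (hχ : 0 < sol.χ t x) :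
    ContDiffAt ℝ (⊤ : ℕ∞) (fun p : ℝ × ℝ =>
      sol.θ p.1 p.2 / ((sol.χ p.1 p.2) ^ α * sol.v p.1 p.2)
        + (pdx sol.χ p.1 p.2) ^ 2 / (2 * (sol.χ p.1 p.2) ^ α * (sol.v p.1 p.2) ^ 2)) (t, x) := by
  have hη := Real.rpow_pos_of_pos hχ α
  have hV := sol.smooth_v.contDiffAt (x := (t, x))
  have hE := sol.contDiffAt_eta hχ
  exact (sol.smooth_θ.contDiffAt.div (hE.mul hV) (by positivity)).add
    ((sol.smooth_χ.contDiffAt.pdx.pow 2).div ((contDiffAt_const.mul hE).mul (hV.pow 2))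
      (by positivity))

/-- The momentum equation divided by the viscosity. -/
theorem NSAC.hasDerivAt_velocity_div_eta (ht : t ∈ S) (hx : x ∈ Icc (0:ℝ) 1)
    (hχ : 0 < sol.χ t x) :
    HasDerivAt (fun τ => sol.u τ x / (sol.χ τ x) ^ α)
      (pdx (fluxEta sol) t x - gfun sol t x) t := by
  have hv := sol.vpos t ht x hx
  have hη := Real.rpow_pos_of_pos hχ α
  have hE := sol.contDiffAt_etaInv hχ
  have hη' : HasDerivAt (fun y => (sol.χ t y) ^ α) (pdx (fun t x => (sol.χ t x) ^ α) t x) x :=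
    ContDiffAt.hasDerivAt_pdx (f := fun t x => (sol.χ t x) ^ α) (sol.contDiffAt_eta hχ)
  have hEx : pdx (etaInv sol) t x
      = -pdx (fun t x => (sol.χ t x) ^ α) t x / ((sol.χ t x) ^ α) ^ 2 :=
    (hη'.fun_inv hη.ne').deriv
  have hflux : HasDerivAt (fluxEta sol t) _ x :=
    (((ContDiffAt.hasDerivAt_pdx (f := fun t x => (sol.χ t x) ^ α * pdx sol.u t x / sol.v t x)
      (sol.contDiffAt_viscous hv hχ)).sub
      (ContDiffAt.hasDerivAt_pdx (f := fun t x => sol.θ t x / sol.v t x)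
        (sol.contDiffAt_pressure hv))).sub
      ((ContDiffAt.hasDerivAt_pdx (f := fun t x => (pdx sol.χ t x) ^ 2 / (sol.v t x) ^ 2)
        (sol.contDiffAt_capillary hv)).const_mul (1 / 2))).mul hE.hasDerivAt_pdx
  have hfx : pdx (fluxEta sol) t x = _ := hflux.deriv
  have hmom := sol.eq_mom t ht x hx
  refine (sol.smooth_u.contDiffAt.hasDerivAt_pdt.mul hE.hasDerivAt_pdt).congr_deriv ?_
  rw [hfx, gfun, eq_sub_of_add_eq hmom, hEx]
  simp only [etaInv, Pi.sub_apply]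
  field_simp
  ring

end Smoothness

/-- Lemma 2.2 (representation formula for the specific volume). -/
theorem stmt_3
    (α β T m₁ m₂ m₃ N : ℝ) (hα : 0 ≤ α) (hβ : 0 < β) (hT : 0 < T)
    (hm₁ : m₁ ≤ 1) (hm₂ : m₂ ≤ 1) (hm₃ : m₃ ≤ 1) (hN : 8 ≤ N)
    (sol : XClass α β T m₁ m₂ m₃ N) :
    ∃ a₀ : ℝ → ℝ, (∀ t ∈ Icc (0:ℝ) T, a₀ t ∈ Ioo (0:ℝ) 1) ∧
      ∀ t ∈ Icc (0:ℝ) T, ∀ x ∈ Icc (0:ℝ) 1,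
        sol.toNSAC.v t x
          = Bfun sol.toNSAC t * Dfun sol.toNSAC a₀ t x
            + ∫ τ in (0:ℝ)..t,
                (Bfun sol.toNSAC t * Dfun sol.toNSAC a₀ t x)
                  / (Bfun sol.toNSAC τ * Dfun sol.toNSAC a₀ τ x)
                  * (sol.toNSAC.v τ x * Jfun sol.toNSAC τ x) := by
  have hχ : ∀ t ∈ Icc (0:ℝ) T, ∀ x ∈ Icc (0:ℝ) 1, 0 < sol.χ t x :=
    fun t ht x hx => sol.m₂pos.trans_le (sol.lb_χ t ht x hx)
  have hv := sol.vpos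
  have rect : ∀ {f : ℝ × ℝ → ℝ},
      (∀ t ∈ Icc (0:ℝ) T, ∀ x ∈ Icc (0:ℝ) 1, ContDiffAt ℝ (⊤ : ℕ∞) f (t, x)) →
      ContinuousOn f (Icc 0 T ×ˢ Icc 0 1) :=
    fun h p hp => (h p.1 hp.1 p.2 hp.2).continuousAt.continuousWithinAt
  set P : ℝ → ℝ → ℝ := fun t x => sol.θ t x / ((sol.χ t x) ^ α * sol.v t x)
    + (pdx sol.χ t x) ^ 2 / (2 * (sol.χ t x) ^ α * (sol.v t x) ^ 2) with hP
  have cP : ContinuousOn (fun p : ℝ × ℝ => P p.1 p.2) (Icc 0 T ×ˢ Icc 0 1) :=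
    rect fun t ht x hx => sol.contDiffAt_scaled_stress (hv t ht x hx) (hχ t ht x hx)
  have cg : ContinuousOn (fun p : ℝ × ℝ => gfun sol.toNSAC p.1 p.2) (Icc 0 T ×ˢ Icc 0 1) :=
    rect fun t ht x hx => sol.contDiffAt_gfun (hv t ht x hx) (hχ t ht x hx)
  have cv : ContinuousOn (fun p : ℝ × ℝ => sol.v p.1 p.2) (Icc 0 T ×ˢ Icc 0 1) :=
    sol.smooth_v.continuous.continuousOn
  have hflux := fun t ht x hx => sol.contDiffAt_fluxEta (hv t ht x hx) (hχ t ht x hx)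
  obtain ⟨a₀, ha₀, hrep⟩ := exists_volume_representation hT.le
    (v := sol.v) (u := sol.u) (ux := pdx sol.u) (w := fun t x => sol.u t x / (sol.χ t x) ^ α)
    (s := fluxEta sol.toNSAC) (sx := pdx (fluxEta sol.toNSAC)) (g := gfun sol.toNSAC) (P := P)
    cv sol.smooth_u.continuous.continuousOn
    (rect fun _ _ _ _ => sol.smooth_u.contDiffAt.pdx)
    (rect fun t ht x hx => sol.contDiffAt_velocity_div_eta (hχ t ht x hx))
    (rect hflux) (rect fun t ht x hx => (hflux t ht x hx).pdx) cg cP hv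
    (fun t ht x hx => sol.eq_mass t ht x hx ▸ sol.smooth_v.contDiffAt.hasDerivAt_pdt)
    (fun _ _ _ _ => sol.smooth_u.contDiffAt.hasDerivAt_pdx)
    (fun t ht x hx => sol.hasDerivAt_velocity_div_eta ht hx (hχ t ht x hx))
    (fun t ht x hx => (hflux t ht x hx).hasDerivAt_pdx)
    (fun t ht x hx => by
      have := (hv t ht x hx).ne'
      have := (Real.rpow_pos_of_pos (hχ t ht x hx) α).ne'
      simp only [fluxEta, etaInv, hP]
      field_simp
      ring)
    sol.bc_u sol.norm_v0
  refine ⟨a₀, ha₀, fun t ht x hx => ?_⟩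
  have hB : ∀ t ∈ Icc (0:ℝ) T, Bfun sol.toNSAC t
      = Real.exp (-∫ τ in (0:ℝ)..t, ∫ z in (0:ℝ)..1,
          (sol.v τ z * P τ z + sol.u τ z * (sol.u τ z / (sol.χ τ z) ^ α))) := by
    intro t ht
    rw [Bfun]
    congr 2
    refine intervalIntegral.integral_congr fun τ hτ => intervalIntegral.integral_congr fun z hz => ?_
    rw [uIcc_of_le ht.1] at hτ
    rw [uIcc_of_le zero_le_one] at hz
    have hτ' : τ ∈ Icc (0:ℝ) T := ⟨hτ.1, hτ.2.trans ht.2⟩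
    have := (hv τ hτ' z hz).ne'
    have := (Real.rpow_pos_of_pos (hχ τ hτ' z hz) α).ne'
    simp only [hP]
    field_simp
    ring
  have cG := continuousOn_rect_primitive_space hT.le cg
  have cJ : ContinuousOn (fun τ => Jfun sol.toNSAC τ x) (Icc 0 T) :=
    ((continuousOn_rect_time cP hx).add
      (continuousOn_rect_time (F := fun t x => ∫ y in (0:ℝ)..x, gfun sol.toNSAC t y) cG hx)).sub
      (continuousOn_integral_space hT.le
        (F := fun t z => sol.v t z * ∫ y in (0:ℝ)..z, gfun sol.toNSAC t y) (cv.mul cG))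
  refine eq_add_integral_of_eq_mul_exp hT.le (z := fun t => sol.v t x)
    (A := fun t => Bfun sol.toNSAC t * Dfun sol.toNSAC a₀ t x) cJ (fun τ _ => ?_)
    (fun τ hτ => ?_) ht
  · exact mul_ne_zero (Real.exp_ne_zero _)
      (mul_ne_zero (hv 0 ⟨le_rfl, hT.le⟩ x hx).ne' (Real.exp_ne_zero _))
  · rw [hB τ hτ]
    exact hrep τ hτ x hx

end
end

section
/- There exist positive constants C₀ and ε₁, depending only on β, V₀ and M₀, such that if (v,u,χ,θ) ∈ X(0,T;m₁,m₂,m₃,N) is a solution of the initial-boundary value problem on [0,1]×[0,T] satisfying the smallness conditions m₂^{−α} ≤ 2, (2N)^α ≤ 1, and α·H(m₁,m₂,m₃,N) ≤ ε₁, where H(m₁,m₂,m₃,N) := (1 + m₁^{−1} + m₂^{−1} + m₃^{−1} + N)⁸, then C₀ ≤ v(x,t) ≤ C₀^{−1} for all (x,t) ∈ [0,1]×[0,T]. -/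
open MeasureTheory Set

noncomputable section

/-! ### Calculus for smooth functions of time and space -/

/-- Joint smoothness of a function of time and space. -/
def SmoothTX (f : ℝ → ℝ → ℝ) : Prop := ContDiff ℝ (⊤ : ℕ∞) (fun p : ℝ × ℝ => f p.1 p.2)

namespace SmoothTX

variable {f g : ℝ → ℝ → ℝ}

theorem continuous (hf : SmoothTX f) : Continuous (fun p : ℝ × ℝ => f p.1 p.2) :=
  ContDiff.continuous hf

theorem differentiable (hf : SmoothTX f) : Differentiable ℝ (fun p : ℝ × ℝ => f p.1 p.2) :=
  ContDiff.differentiable hf (by simp)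

theorem continuous_space (hf : SmoothTX f) (t : ℝ) : Continuous (f t) :=
  hf.continuous.comp (Continuous.prodMk_right t)

theorem continuous_time (hf : SmoothTX f) (x : ℝ) : Continuous (fun t => f t x) :=
  hf.continuous.comp (Continuous.prodMk_left x)

theorem hasDerivAt_space_fderiv (hf : SmoothTX f) (t x : ℝ) :
    HasDerivAt (f t) (fderiv ℝ (fun p : ℝ × ℝ => f p.1 p.2) (t, x) (0, 1)) x := by
  have h := (hf.differentiable (t, x)).hasFDerivAt
  have h2 : HasDerivAt (fun y : ℝ => (t, y)) ((0 : ℝ), (1 : ℝ)) x :=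
    (hasDerivAt_const x t).prodMk (hasDerivAt_id x)
  exact h.comp_hasDerivAt x h2

theorem hasDerivAt_time_fderiv (hf : SmoothTX f) (t x : ℝ) :
    HasDerivAt (fun s => f s x) (fderiv ℝ (fun p : ℝ × ℝ => f p.1 p.2) (t, x) (1, 0)) t := by
  have h := (hf.differentiable (t, x)).hasFDerivAt
  have h2 : HasDerivAt (fun s : ℝ => (s, x)) ((1 : ℝ), (0 : ℝ)) t :=
    (hasDerivAt_id t).prodMk (hasDerivAt_const t x)
  exact h.comp_hasDerivAt t h2

theorem pdx_eq (hf : SmoothTX f) (t x : ℝ) :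
    pdx f t x = fderiv ℝ (fun p : ℝ × ℝ => f p.1 p.2) (t, x) (0, 1) :=
  (hf.hasDerivAt_space_fderiv t x).deriv

theorem pdt_eq (hf : SmoothTX f) (t x : ℝ) :
    pdt f t x = fderiv ℝ (fun p : ℝ × ℝ => f p.1 p.2) (t, x) (1, 0) :=
  (hf.hasDerivAt_time_fderiv t x).deriv

theorem hasDerivAt_space (hf : SmoothTX f) (t x : ℝ) : HasDerivAt (f t) (pdx f t x) x := by
  rw [hf.pdx_eq]; exact hf.hasDerivAt_space_fderiv t x

theorem hasDerivAt_time (hf : SmoothTX f) (t x : ℝ) :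
    HasDerivAt (fun s => f s x) (pdt f t x) t := by
  rw [hf.pdt_eq]; exact hf.hasDerivAt_time_fderiv t x

theorem fderiv_smooth (hf : SmoothTX f) :
    ContDiff ℝ (⊤ : ℕ∞) (fderiv ℝ (fun p : ℝ × ℝ => f p.1 p.2)) :=
  ContDiff.fderiv_right hf (by simp)

theorem pdx (hf : SmoothTX f) : SmoothTX (pdx f) := by
  have h : (fun p : ℝ × ℝ => _root_.pdx f p.1 p.2)
      = fun p => fderiv ℝ (fun p : ℝ × ℝ => f p.1 p.2) p (0, 1) := by
    funext p; exact hf.pdx_eq p.1 p.2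
  unfold SmoothTX
  rw [h]
  exact hf.fderiv_smooth.clm_apply contDiff_const

theorem pdt (hf : SmoothTX f) : SmoothTX (pdt f) := by
  have h : (fun p : ℝ × ℝ => _root_.pdt f p.1 p.2)
      = fun p => fderiv ℝ (fun p : ℝ × ℝ => f p.1 p.2) p (1, 0) := by
    funext p; exact hf.pdt_eq p.1 p.2
  unfold SmoothTX
  rw [h]
  exact hf.fderiv_smooth.clm_apply contDiff_const

theorem pdt_pdx_comm (hf : SmoothTX f) (t x : ℝ) :
    _root_.pdt (_root_.pdx f) t x = _root_.pdx (_root_.pdt f) t x := by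
  have hsymm : IsSymmSndFDerivAt ℝ (fun p : ℝ × ℝ => f p.1 p.2) (t, x) :=
    ContDiffAt.isSymmSndFDerivAt (ContDiff.contDiffAt hf) (by
      rw [minSmoothness_of_isRCLikeNormedField]; exact WithTop.coe_le_coe.2 (le_top : (2 : ℕ∞) ≤ ⊤))
  have hd : Differentiable ℝ (fderiv ℝ (fun p : ℝ × ℝ => f p.1 p.2)) :=
    hf.fderiv_smooth.differentiable (by simp)
  have key : ∀ w : ℝ × ℝ, fderiv ℝ (fun p => fderiv ℝ (fun p : ℝ × ℝ => f p.1 p.2) p w) (t, x)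
      = (fderiv ℝ (fderiv ℝ (fun p : ℝ × ℝ => f p.1 p.2)) (t, x)).flip w := by
    intro w
    ext <;> simp [fderiv_clm_apply (hd (t, x)) (differentiableAt_const w)]
  rw [hf.pdx.pdt_eq, hf.pdt.pdx_eq]
  have h1 : (fun p : ℝ × ℝ => _root_.pdx f p.1 p.2)
      = fun p => fderiv ℝ (fun p : ℝ × ℝ => f p.1 p.2) p (0, 1) := by
    funext p; exact hf.pdx_eq p.1 p.2
  have h2 : (fun p : ℝ × ℝ => _root_.pdt f p.1 p.2)
      = fun p => fderiv ℝ (fun p : ℝ × ℝ => f p.1 p.2) p (1, 0) := by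
    funext p; exact hf.pdt_eq p.1 p.2
  rw [h1, h2, key, key]
  exact hsymm _ _

theorem const (c : ℝ) : SmoothTX (fun _ _ => c) := contDiff_const

theorem add (hf : SmoothTX f) (hg : SmoothTX g) : SmoothTX (fun t x => f t x + g t x) :=
  ContDiff.add hf hg

theorem sub (hf : SmoothTX f) (hg : SmoothTX g) : SmoothTX (fun t x => f t x - g t x) :=
  ContDiff.sub hf hg

theorem neg (hf : SmoothTX f) : SmoothTX (fun t x => -f t x) :=
  ContDiff.neg hf

theorem mul (hf : SmoothTX f) (hg : SmoothTX g) : SmoothTX (fun t x => f t x * g t x) :=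
  ContDiff.mul hf hg

theorem pow (hf : SmoothTX f) (n : ℕ) : SmoothTX (fun t x => f t x ^ n) :=
  ContDiff.pow hf n

theorem div (hf : SmoothTX f) (hg : SmoothTX g) (h : ∀ t x, 0 < g t x) :
    SmoothTX (fun t x => f t x / g t x) :=
  ContDiff.div hf hg fun p => (h p.1 p.2).ne'

theorem log (hf : SmoothTX f) (h : ∀ t x, 0 < f t x) :
    SmoothTX (fun t x => Real.log (f t x)) :=
  ContDiff.log hf fun p => (h p.1 p.2).ne'

theorem rpow_const (hf : SmoothTX f) (h : ∀ t x, 0 < f t x) (r : ℝ) :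
    SmoothTX (fun t x => f t x ^ r) :=
  ContDiff.rpow_const_of_ne hf fun p => (h p.1 p.2).ne'

end SmoothTX

/-- Fubini's theorem for a jointly continuous integrand on a rectangle. -/
theorem intervalIntegral_swap_of_continuous {f : ℝ → ℝ → ℝ}
    (hf : Continuous (fun p : ℝ × ℝ => f p.1 p.2)) {t b : ℝ} (ht : 0 ≤ t) (hb : 0 ≤ b) :
    ∫ x in (0:ℝ)..b, ∫ s in (0:ℝ)..t, f s x = ∫ s in (0:ℝ)..t, ∫ x in (0:ℝ)..b, f s x := by
  simp only [intervalIntegral.integral_of_le ht, intervalIntegral.integral_of_le hb]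
  symm
  apply integral_integral_swap
  rw [Measure.prod_restrict, ← Measure.volume_eq_prod]
  have : IntegrableOn (Function.uncurry f) (Icc 0 t ×ˢ Icc 0 b) :=
    (ContinuousOn.integrableOn_compact (isCompact_Icc.prod isCompact_Icc) hf.continuousOn)
  exact this.mono_set (prod_mono Ioc_subset_Icc_self Ioc_subset_Icc_self)

/-- Continuity in time of a spatial integral. -/
theorem continuous_intervalIntegral_space {f : ℝ → ℝ → ℝ}
    (hf : Continuous (fun p : ℝ × ℝ => f p.1 p.2)) (a b : ℝ) :
    Continuous (fun t => ∫ x in a..b, f t x) :=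
  intervalIntegral.continuous_parametric_intervalIntegral_of_continuous' hf a b

/-- Integrating a pointwise time derivative over a rectangle. -/
theorem integral_space_sub_eq_of_hasDerivAt_time {F G : ℝ → ℝ → ℝ}
    (hF : Continuous (fun p : ℝ × ℝ => F p.1 p.2)) (hG : Continuous (fun p : ℝ × ℝ => G p.1 p.2))
    {t b : ℝ} (ht : 0 ≤ t) (hb : 0 ≤ b)
    (hd : ∀ s ∈ Ioo 0 t, ∀ x ∈ Icc 0 b, HasDerivAt (fun r => F r x) (G s x) s) :
    (∫ x in (0:ℝ)..b, F t x) - ∫ x in (0:ℝ)..b, F 0 x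
      = ∫ s in (0:ℝ)..t, ∫ x in (0:ℝ)..b, G s x := by
  have hFt : ∀ r, Continuous (F r) := fun r => hF.comp (Continuous.prodMk_right r)
  rw [← intervalIntegral.integral_sub ((hFt t).intervalIntegrable _ _)
    ((hFt 0).intervalIntegrable _ _), ← intervalIntegral_swap_of_continuous hG ht hb]
  apply intervalIntegral.integral_congr
  intro x hx
  rw [uIcc_of_le hb] at hx
  have hGx : Continuous (fun s => G s x) := hG.comp (Continuous.prodMk_left x)
  have hFx : Continuous (fun s => F s x) := hF.comp (Continuous.prodMk_left x)
  exact (intervalIntegral.integral_eq_sub_of_hasDerivAt_of_le ht hFx.continuousOn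
    (fun s hs => hd s hs x hx) (hGx.intervalIntegrable _ _)).symm

/-- The integrated form of a local balance law `∂ₜ F = G + ∂ₓ H`. -/
theorem integral_balance {F H G : ℝ → ℝ → ℝ} (hF : SmoothTX F) (hH : SmoothTX H)
    (hG : Continuous (fun p : ℝ × ℝ => G p.1 p.2)) {t b : ℝ} (ht : 0 ≤ t) (hb : 0 ≤ b)
    (hd : ∀ s ∈ Icc 0 t, ∀ x ∈ Icc 0 b, pdt F s x = G s x + pdx H s x) :
    (∫ x in (0:ℝ)..b, F t x) - ∫ x in (0:ℝ)..b, F 0 x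
      = ∫ s in (0:ℝ)..t, ((∫ x in (0:ℝ)..b, G s x) + (H s b - H s 0)) := by
  have hGs : ∀ r, Continuous (G r) := fun r => hG.comp (Continuous.prodMk_right r)
  rw [integral_space_sub_eq_of_hasDerivAt_time (G := fun s x => G s x + pdx H s x)
    hF.continuous (hG.add hH.pdx.continuous) ht hb
    (fun s hs x hx => by
      rw [← hd s ⟨hs.1.le, hs.2.le⟩ x hx]; exact hF.hasDerivAt_time s x)]
  apply intervalIntegral.integral_congr
  intro s _
  have hHs : Continuous (pdx H s) := hH.pdx.continuous_space s
  simp only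
  rw [intervalIntegral.integral_add ((hGs s).intervalIntegrable _ _)
    (hHs.intervalIntegrable _ _)]
  congr 1
  exact intervalIntegral.integral_eq_sub_of_hasDerivAt (fun x _ => hH.hasDerivAt_space s x)
    (hHs.intervalIntegrable _ _)

/-- A conservation law with equal boundary fluxes. -/
theorem integral_balance_of_flux_eq {F H G : ℝ → ℝ → ℝ} (hF : SmoothTX F) (hH : SmoothTX H)
    (hG : Continuous (fun p : ℝ × ℝ => G p.1 p.2)) {t b : ℝ} (ht : 0 ≤ t) (hb : 0 ≤ b)
    (hd : ∀ s ∈ Icc 0 t, ∀ x ∈ Icc 0 b, pdt F s x = G s x + pdx H s x)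
    (hflux : ∀ s ∈ Icc 0 t, H s b = H s 0) :
    (∫ x in (0:ℝ)..b, F t x) - ∫ x in (0:ℝ)..b, F 0 x
      = ∫ s in (0:ℝ)..t, ∫ x in (0:ℝ)..b, G s x := by
  rw [integral_balance hF hH hG ht hb hd]
  apply intervalIntegral.integral_congr
  intro s hs
  rw [uIcc_of_le ht] at hs
  simp [hflux s hs]

/-! ### One-dimensional inequalities -/

/-- Cauchy–Schwarz inequality for continuous functions on an interval. -/
theorem sq_intervalIntegral_mul_le {f g : ℝ → ℝ} (hf : Continuous f) (hg : Continuous g)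
    {a b : ℝ} (hab : a ≤ b) :
    (∫ x in a..b, f x * g x) ^ 2 ≤ (∫ x in a..b, f x ^ 2) * ∫ x in a..b, g x ^ 2 := by
  have h : ∀ r : ℝ, 0 ≤ (∫ x in a..b, g x ^ 2) * (r * r)
      + (-2 * ∫ x in a..b, f x * g x) * r + ∫ x in a..b, f x ^ 2 := by
    intro r
    have h1 : (∫ x in a..b, (f x - r * g x) ^ 2)
        = (∫ x in a..b, g x ^ 2) * (r * r)
          + (-2 * ∫ x in a..b, f x * g x) * r + ∫ x in a..b, f x ^ 2 := by
      have : ∀ x, (f x - r * g x) ^ 2 = (r * r) * g x ^ 2 + (-2 * r) * (f x * g x) + f x ^ 2 :=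
        fun x => by ring
      simp_rw [this]
      rw [intervalIntegral.integral_add, intervalIntegral.integral_add,
        intervalIntegral.integral_const_mul, intervalIntegral.integral_const_mul]
      · ring
      all_goals exact Continuous.intervalIntegrable (by fun_prop) _ _
    rw [← h1]
    exact intervalIntegral.integral_nonneg hab fun x _ => sq_nonneg _
  have := discrim_le_zero h
  unfold discrim at this
  nlinarith

theorem intervalIntegral_abs_le_sqrt_mul_sqrt {f g h : ℝ → ℝ} (hh : Continuous h)
    (hf : Continuous f) (hg : Continuous g) {a b : ℝ} (hab : a ≤ b)
    (hle : ∀ x ∈ Icc a b, |h x| ≤ f x * g x) :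
    ∫ x in a..b, |h x|
      ≤ Real.sqrt (∫ x in a..b, f x ^ 2) * Real.sqrt (∫ x in a..b, g x ^ 2) := by
  have h1 : ∫ x in a..b, |h x| ≤ ∫ x in a..b, f x * g x :=
    intervalIntegral.integral_mono_on hab (hh.abs.intervalIntegrable _ _)
      ((hf.mul hg).intervalIntegrable _ _) hle
  rw [← Real.sqrt_mul (intervalIntegral.integral_nonneg hab fun x _ => sq_nonneg _)]
  exact h1.trans (Real.le_sqrt_of_sq_le (sq_intervalIntegral_mul_le hf hg hab))

theorem intervalIntegral_mono_interval_of_nonneg {f : ℝ → ℝ} (hf : Continuous f) {a b c d : ℝ}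
    (hca : c ≤ a) (hab : a ≤ b) (hbd : b ≤ d) (h0 : ∀ x ∈ Icc c d, 0 ≤ f x) :
    ∫ x in a..b, f x ≤ ∫ x in c..d, f x := by
  apply intervalIntegral.integral_mono_interval hca hab hbd _ (hf.intervalIntegrable _ _)
  filter_upwards [ae_restrict_mem measurableSet_Ioc] with x hx
  exact h0 x ⟨hx.1.le, hx.2⟩

theorem abs_sub_le_integral_abs_deriv {f f' : ℝ → ℝ} (hf : ∀ x, HasDerivAt f (f' x) x)
    (hf' : Continuous f') {x y : ℝ} (hxy : x ≤ y) :
    |f y - f x| ≤ ∫ z in x..y, |f' z| := by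
  rw [← intervalIntegral.integral_eq_sub_of_hasDerivAt (fun z _ => hf z)
    (hf'.intervalIntegrable _ _)]
  exact intervalIntegral.abs_integral_le_integral_abs hxy

theorem abs_sub_le_integral_abs_deriv_unit {f f' : ℝ → ℝ} (hf : ∀ x, HasDerivAt f (f' x) x)
    (hf' : Continuous f') {x y : ℝ} (hx : x ∈ Icc (0:ℝ) 1) (hy : y ∈ Icc (0:ℝ) 1) :
    |f y - f x| ≤ ∫ z in (0:ℝ)..1, |f' z| := by
  rcases le_total x y with h | h
  · exact (abs_sub_le_integral_abs_deriv hf hf' h).trans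
      (intervalIntegral_mono_interval_of_nonneg hf'.abs hx.1 h hy.2 fun _ _ => abs_nonneg _)
  · rw [abs_sub_comm]
    exact (abs_sub_le_integral_abs_deriv hf hf' h).trans
      (intervalIntegral_mono_interval_of_nonneg hf'.abs hy.1 h hx.2 fun _ _ => abs_nonneg _)

theorem exists_le_unit_integral {f : ℝ → ℝ} (hf : Continuous f) :
    ∃ a ∈ Icc (0:ℝ) 1, f a ≤ ∫ x in (0:ℝ)..1, f x := by
  obtain ⟨a, ha, hmin⟩ := isCompact_Icc.exists_isMinOn
    (nonempty_Icc.2 (zero_le_one (α := ℝ))) hf.continuousOn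
  refine ⟨a, ha, ?_⟩
  have : ∫ _ in (0:ℝ)..1, f a ≤ ∫ x in (0:ℝ)..1, f x :=
    intervalIntegral.integral_mono_on zero_le_one (by simp) (hf.intervalIntegrable _ _)
      fun x hx => hmin hx
  simpa using this

theorem exists_ge_unit_integral {f : ℝ → ℝ} (hf : Continuous f) :
    ∃ a ∈ Icc (0:ℝ) 1, ∫ x in (0:ℝ)..1, f x ≤ f a := by
  obtain ⟨a, ha, h⟩ := exists_le_unit_integral (f := fun x => -f x) hf.neg
  refine ⟨a, ha, ?_⟩
  rw [intervalIntegral.integral_neg] at h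
  linarith

theorem exists_last_eq_one {f : ℝ → ℝ} (hf : Continuous f) {a x : ℝ} (hax : a ≤ x)
    (ha : f a ≤ 1) (hx : 1 ≤ f x) :
    ∃ b ∈ Icc a x, f b = 1 ∧ ∀ y ∈ Icc b x, 1 ≤ f y := by
  have hS : IsCompact (Icc a x ∩ f ⁻¹' Iic 1) :=
    isCompact_Icc.inter_right (isClosed_Iic.preimage hf)
  obtain ⟨b, ⟨hb, hfb⟩, hmax⟩ := hS.exists_isGreatest ⟨a, ⟨le_refl a, hax⟩, ha⟩
  have hgt : ∀ y ∈ Icc b x, y ≠ b → 1 < f y := by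
    intro y hy hne
    by_contra! hcon
    exact hne (le_antisymm (hmax ⟨⟨hb.1.trans hy.1, hy.2⟩, hcon⟩) hy.1)
  have hfb1 : f b = 1 := by
    obtain ⟨y, hy, hfy⟩ := intermediate_value_Icc hb.2 hf.continuousOn ⟨hfb, hx⟩
    by_cases hyb : y = b
    · rw [← hyb, hfy]
    · exact absurd hfy (hgt y hy hyb).ne'
  refine ⟨b, hb, hfb1, fun y hy => ?_⟩
  by_cases hyb : y = b
  · rw [hyb, hfb1]
  · exact (hgt y hy hyb).le

theorem exists_first_eq_one {f : ℝ → ℝ} (hf : Continuous f) {a x : ℝ} (hax : x ≤ a)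
    (ha : f a ≤ 1) (hx : 1 ≤ f x) :
    ∃ b ∈ Icc x a, f b = 1 ∧ ∀ y ∈ Icc x b, 1 ≤ f y := by
  obtain ⟨b, hb, hb1, h⟩ := exists_last_eq_one (f := fun y => f (-y)) (by fun_prop)
    (neg_le_neg hax) (by simpa using ha) (by simpa using hx)
  refine ⟨-b, ⟨by linarith [hb.2], by linarith [hb.1]⟩, hb1, fun y hy => ?_⟩
  simpa using h (-y) ⟨by linarith [hy.2], by linarith [hy.1]⟩

/-! ### Integral equations in time -/

/-- Grönwall's inequality in integral form with a nonnegative continuous kernel. -/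
theorem le_mul_exp_of_le_add_integral {m k : ℝ → ℝ} (hm : Continuous m) (hk : Continuous k)
    {T c : ℝ} (hk0 : ∀ t ∈ Icc 0 T, 0 ≤ k t)
    (h : ∀ t ∈ Icc 0 T, m t ≤ c + ∫ s in (0:ℝ)..t, k s * m s) :
    ∀ t ∈ Icc 0 T, m t ≤ c * Real.exp (∫ s in (0:ℝ)..t, k s) := by
  have hz : ∀ t, HasDerivAt (fun t => c + ∫ s in (0:ℝ)..t, k s * m s) (k t * m t) t := fun t =>
    ((hk.mul hm).integral_hasStrictDerivAt 0 t).hasDerivAt.const_add c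
  have he : ∀ t, HasDerivAt (fun t => Real.exp (-∫ s in (0:ℝ)..t, k s))
      (Real.exp (-∫ s in (0:ℝ)..t, k s) * (-(k t))) t := fun t =>
    ((hk.integral_hasStrictDerivAt 0 t).hasDerivAt.neg).exp
  have hanti : AntitoneOn (fun t => (c + ∫ s in (0:ℝ)..t, k s * m s)
      * Real.exp (-∫ s in (0:ℝ)..t, k s)) (Icc 0 T) := by
    have hd := fun t => (hz t).mul (he t)
    apply antitoneOn_of_hasDerivWithinAt_nonpos (convex_Icc 0 T)
      (fun t _ => (hd t).continuousAt.continuousWithinAt) (fun t _ => (hd t).hasDerivWithinAt)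
    intro t ht
    have ht' := interior_subset ht
    have h1 := h t ht'
    have h2 := mul_le_mul_of_nonneg_left h1 (hk0 t ht')
    have h3 := Real.exp_pos (-∫ s in (0:ℝ)..t, k s)
    nlinarith
  intro t ht
  have h1 := hanti ⟨le_refl _, ht.1.trans ht.2⟩ ht ht.1
  simp only [intervalIntegral.integral_same, neg_zero, Real.exp_zero, add_zero, mul_one] at h1
  rw [Real.exp_neg, ← div_eq_mul_inv, div_le_iff₀ (Real.exp_pos _)] at h1
  exact (h t ht).trans h1

/-- Solving the implicit relation `log y = d - p + ∫ Q / y` for `y`. -/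
theorem eq_exp_mul_of_log_eq {y d p Q : ℝ → ℝ} (hy : Continuous y) (hQ : Continuous Q)
    (hpos : ∀ t, 0 < y t) {T : ℝ}
    (h : ∀ t ∈ Icc 0 T, Real.log (y t) = d t - p t + ∫ s in (0:ℝ)..t, Q s / y s) :
    ∀ t ∈ Icc 0 T, y t = Real.exp (d t - p t)
      * (1 + ∫ s in (0:ℝ)..t, Q s * Real.exp (p s - d s)) := by
  have hQy : Continuous (fun s => Q s / y s) := hQ.div hy fun s => (hpos s).ne'
  have hyexp : ∀ t ∈ Icc 0 T, y t
      = Real.exp (d t - p t) * Real.exp (∫ s in (0:ℝ)..t, Q s / y s) := by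
    intro t ht
    rw [← Real.exp_add, ← h t ht, Real.exp_log (hpos t)]
  intro t ht
  rw [hyexp t ht]
  congr 1
  have hder : ∀ s, HasDerivAt (fun t => Real.exp (∫ s in (0:ℝ)..t, Q s / y s))
      (Real.exp (∫ r in (0:ℝ)..s, Q r / y r) * (Q s / y s)) s := fun s =>
    (hQy.integral_hasStrictDerivAt 0 s).hasDerivAt.exp
  have hc : Continuous (fun s => Real.exp (∫ r in (0:ℝ)..s, Q r / y r) * (Q s / y s)) :=
    (continuous_iff_continuousAt.2 fun s => (hder s).continuousAt).mul hQy
  have h1 := intervalIntegral.integral_eq_sub_of_hasDerivAt (a := 0) (b := t)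
    (fun s _ => hder s) (hc.intervalIntegrable _ _)
  simp only [intervalIntegral.integral_same, Real.exp_zero] at h1
  have h2 : ∫ s in (0:ℝ)..t, Q s * Real.exp (p s - d s)
      = ∫ s in (0:ℝ)..t, Real.exp (∫ r in (0:ℝ)..s, Q r / y r) * (Q s / y s) := by
    apply intervalIntegral.integral_congr
    intro s hs
    rw [uIcc_of_le ht.1] at hs
    have h3 := hyexp s ⟨hs.1, hs.2.trans ht.2⟩
    have h4 : Real.exp (p s - d s) * Real.exp (d s - p s) = 1 := by
      rw [← Real.exp_add]; simp
    have h5 := (hpos s).ne'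
    simp only
    rw [← mul_div_assoc, eq_div_iff h5]
    linear_combination (Q s * Real.exp (p s - d s)) * h3
      + (Q s * Real.exp (∫ r in (0:ℝ)..s, Q r / y r)) * h4
  rw [h2, h1]; ring

/-- Bounds for the solution of `log y = d - p + ∫ Q / y` when `d` is bounded and `p` grows
at a rate between `c` and `2`. -/
theorem bounds_of_log_eq {y d p Q : ℝ → ℝ} (hy : Continuous y) (hd : Continuous d)
    (hp : Continuous p) (hQ : Continuous Q) (hpos : ∀ t, 0 < y t) {T K c : ℝ}
    (h : ∀ t ∈ Icc 0 T, Real.log (y t) = d t - p t + ∫ s in (0:ℝ)..t, Q s / y s)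
    (hQ0 : ∀ t ∈ Icc 0 T, 0 ≤ Q t) (hdK : ∀ t ∈ Icc 0 T, |d t| ≤ K) (hp0 : p 0 = 0)
    (hpl : ∀ s t, 0 ≤ s → s ≤ t → t ≤ T → c * (t - s) ≤ p t - p s)
    (hpu : ∀ s t, 0 ≤ s → s ≤ t → t ≤ T → p t - p s ≤ 2 * (t - s)) :
    ∀ t ∈ Icc 0 T, Real.exp (-K - 2 * t) ≤ y t
      ∧ Real.exp (-2 * K) * (∫ s in (0:ℝ)..t, Q s * Real.exp (-2 * (t - s))) ≤ y t
      ∧ y t ≤ Real.exp (K - c * t)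
        + Real.exp (2 * K) * ∫ s in (0:ℝ)..t, Q s * Real.exp (-c * (t - s)) := by
  intro t ht
  have key := eq_exp_mul_of_log_eq hy hQ hpos h t ht
  have hdt := abs_le.1 (hdK t ht)
  rw [mul_add, mul_one, ← intervalIntegral.integral_const_mul] at key
  have hrw : ∀ s, Real.exp (d t - p t) * (Q s * Real.exp (p s - d s))
      = Q s * Real.exp (d t - p t + (p s - d s)) := fun s => by rw [Real.exp_add]; ring
  simp_rw [hrw] at key
  have hI0 : 0 ≤ ∫ s in (0:ℝ)..t, Q s * Real.exp (d t - p t + (p s - d s)) :=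
    intervalIntegral.integral_nonneg ht.1 fun s hs =>
      mul_nonneg (hQ0 s ⟨hs.1, hs.2.trans ht.2⟩) (Real.exp_pos _).le
  have hpt := hpu 0 t le_rfl ht.1 ht.2
  have hpt' := hpl 0 t le_rfl ht.1 ht.2
  rw [hp0] at hpt hpt'
  refine ⟨?_, ?_, ?_⟩
  · rw [key]
    have : Real.exp (-K - 2 * t) ≤ Real.exp (d t - p t) := Real.exp_le_exp.2 (by linarith)
    linarith
  · have : Real.exp (-2 * K) * (∫ s in (0:ℝ)..t, Q s * Real.exp (-2 * (t - s)))
        ≤ ∫ s in (0:ℝ)..t, Q s * Real.exp (d t - p t + (p s - d s)) := by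
      rw [← intervalIntegral.integral_const_mul]
      apply intervalIntegral.integral_mono_on ht.1
      · exact Continuous.intervalIntegrable (by fun_prop) _ _
      · exact Continuous.intervalIntegrable (by fun_prop) _ _
      · intro s hs
        have hs' : s ∈ Icc 0 T := ⟨hs.1, hs.2.trans ht.2⟩
        rw [mul_left_comm, ← Real.exp_add]
        apply mul_le_mul_of_nonneg_left (Real.exp_le_exp.2 _) (hQ0 s hs')
        have := abs_le.1 (hdK s hs')
        have := hpu s t hs.1 hs.2 ht.2
        linarith
    have h0 := Real.exp_pos (d t - p t)
    rw [key]; linarith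
  · have : (∫ s in (0:ℝ)..t, Q s * Real.exp (d t - p t + (p s - d s)))
        ≤ Real.exp (2 * K) * (∫ s in (0:ℝ)..t, Q s * Real.exp (-c * (t - s))) := by
      rw [← intervalIntegral.integral_const_mul]
      apply intervalIntegral.integral_mono_on ht.1
      · exact Continuous.intervalIntegrable (by fun_prop) _ _
      · exact Continuous.intervalIntegrable (by fun_prop) _ _
      · intro s hs
        have hs' : s ∈ Icc 0 T := ⟨hs.1, hs.2.trans ht.2⟩
        rw [mul_left_comm, ← Real.exp_add]
        apply mul_le_mul_of_nonneg_left (Real.exp_le_exp.2 _) (hQ0 s hs')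
        have := abs_le.1 (hdK s hs')
        have := hpl s t hs.1 hs.2 ht.2
        linarith
    have h0 : Real.exp (d t - p t) ≤ Real.exp (K - c * t) := Real.exp_le_exp.2 (by linarith)
    rw [key]; linarith

/-! ### Constant-viscosity flows with globally positive volume and temperature -/

/-- A solution of the system with unit viscosity on `[0,1] × [0,T]`, extended to smooth functions
on the plane in such a way that volume and temperature are positive everywhere, together with the
bounds on the initial data that enter the a priori estimates. -/
structure RegularFlow (β T V₀ R : ℝ) where
  v : ℝ → ℝ → ℝ
  u : ℝ → ℝ → ℝ
  χ : ℝ → ℝ → ℝ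
  θ : ℝ → ℝ → ℝ
  smooth_v : SmoothTX v
  smooth_u : SmoothTX u
  smooth_χ : SmoothTX χ
  smooth_θ : SmoothTX θ
  v_pos : ∀ t x, 0 < v t x
  θ_pos : ∀ t x, 0 < θ t x
  χ_pos : ∀ t ∈ Icc (0:ℝ) T, ∀ x ∈ Icc (0:ℝ) 1, 0 < χ t x
  mass : ∀ t ∈ Icc (0:ℝ) T, ∀ x ∈ Icc (0:ℝ) 1, pdt v t x = pdx u t x
  momentum : ∀ t ∈ Icc (0:ℝ) T, ∀ x ∈ Icc (0:ℝ) 1, pdt u t x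
    = pdx (fun t x => pdx u t x / v t x - θ t x / v t x - (pdx χ t x / v t x) ^ 2 / 2) t x
  phase : ∀ t ∈ Icc (0:ℝ) T, ∀ x ∈ Icc (0:ℝ) 1, pdt χ t x
    = -(v t x * (-(pdx (fun t x => pdx χ t x / v t x) t x) + ((χ t x) ^ 3 - χ t x)))
  temperature : ∀ t ∈ Icc (0:ℝ) T, ∀ x ∈ Icc (0:ℝ) 1,
    pdt θ t x + (θ t x / v t x) * pdx u t x
      = pdx (fun t x => (θ t x) ^ β * pdx θ t x / v t x) t x + (pdx u t x) ^ 2 / v t x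
        + v t x * (-(pdx (fun t x => pdx χ t x / v t x) t x) + ((χ t x) ^ 3 - χ t x)) ^ 2
  bc_u : ∀ t ∈ Icc (0:ℝ) T, u t 0 = 0 ∧ u t 1 = 0
  bc_χ : ∀ t ∈ Icc (0:ℝ) T, pdx χ t 0 = 0 ∧ pdx χ t 1 = 0
  bc_θ : ∀ t ∈ Icc (0:ℝ) T, pdx θ t 0 = 0 ∧ pdx θ t 1 = 0
  T_nonneg : 0 ≤ T
  V₀_pos : 0 < V₀
  initial_volume : (∫ x in (0:ℝ)..1, v 0 x) = 1
  initial_energy : (∫ x in (0:ℝ)..1,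
      (θ 0 x + (u 0 x) ^ 2 / 2 + ((χ 0 x) ^ 2 - 1) ^ 2 / 4 + (pdx χ 0 x) ^ 2 / (2 * v 0 x))) = 1
  initial_v_ge : ∀ x ∈ Icc (0:ℝ) 1, V₀ ≤ v 0 x
  initial_v_le : ∀ x ∈ Icc (0:ℝ) 1, v 0 x ≤ R
  initial_χ_le : ∀ x ∈ Icc (0:ℝ) 1, χ 0 x ≤ 1
  initial_θ_ge : ∀ x ∈ Icc (0:ℝ) 1, V₀ ≤ θ 0 x

namespace RegularFlow

variable {β T V₀ R : ℝ} (S : RegularFlow β T V₀ R)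

/-- The phase-field gradient in Eulerian coordinates, `χ_x / v`. -/
def q : ℝ → ℝ → ℝ := fun t x => pdx S.χ t x / S.v t x

/-- The chemical potential. -/
def mu : ℝ → ℝ → ℝ := fun t x => -(pdx S.q t x) + ((S.χ t x) ^ 3 - S.χ t x)

/-- The total stress. -/
def sigma : ℝ → ℝ → ℝ := fun t x =>
  pdx S.u t x / S.v t x - S.θ t x / S.v t x - (S.q t x) ^ 2 / 2

/-- The heat flux `θ^β θ_x / v`. -/
def kappa : ℝ → ℝ → ℝ := fun t x => (S.θ t x) ^ β * pdx S.θ t x / S.v t x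

/-- The entropy production density. -/
def w : ℝ → ℝ → ℝ := fun t x =>
  S.kappa t x * pdx S.θ t x / S.θ t x ^ 2
    + (pdx S.u t x) ^ 2 / (S.v t x * S.θ t x) + S.v t x * (S.mu t x) ^ 2 / S.θ t x

/-- The total entropy production. -/
def W : ℝ → ℝ := fun t => ∫ x in (0:ℝ)..1, S.w t x

/-- The total energy density. -/
def energy : ℝ → ℝ → ℝ := fun t x =>
  S.θ t x + (S.u t x) ^ 2 / 2 + ((S.χ t x) ^ 2 - 1) ^ 2 / 4 + (pdx S.χ t x) ^ 2 / (2 * S.v t x)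

theorem smooth_q : SmoothTX S.q := S.smooth_χ.pdx.div S.smooth_v S.v_pos

theorem smooth_mu : SmoothTX S.mu :=
  S.smooth_q.pdx.neg.add ((S.smooth_χ.pow 3).sub S.smooth_χ)

theorem smooth_sigma : SmoothTX S.sigma :=
  ((S.smooth_u.pdx.div S.smooth_v S.v_pos).sub (S.smooth_θ.div S.smooth_v S.v_pos)).sub
    ((S.smooth_q.pow 2).div (SmoothTX.const 2) fun _ _ => two_pos)

theorem smooth_kappa : SmoothTX S.kappa :=
  ((S.smooth_θ.rpow_const S.θ_pos β).mul S.smooth_θ.pdx).div S.smooth_v S.v_pos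

theorem smooth_w : SmoothTX S.w :=
  (((S.smooth_kappa.mul S.smooth_θ.pdx).div (S.smooth_θ.pow 2)
      fun t x => pow_pos (S.θ_pos t x) 2).add
    ((S.smooth_u.pdx.pow 2).div (S.smooth_v.mul S.smooth_θ)
      fun t x => mul_pos (S.v_pos t x) (S.θ_pos t x))).add
    ((S.smooth_v.mul (S.smooth_mu.pow 2)).div S.smooth_θ S.θ_pos)

theorem smooth_energy : SmoothTX S.energy :=
  ((S.smooth_θ.add ((S.smooth_u.pow 2).div (SmoothTX.const 2) fun _ _ => two_pos)).add
    ((((S.smooth_χ.pow 2).sub (SmoothTX.const 1)).pow 2).div (SmoothTX.const 4)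
      fun _ _ => four_pos)).add
    ((S.smooth_χ.pdx.pow 2).div ((SmoothTX.const 2).mul S.smooth_v)
      fun t x => mul_pos two_pos (S.v_pos t x))

theorem continuous_W : Continuous S.W :=
  continuous_intervalIntegral_space S.smooth_w.continuous 0 1

theorem heat_dissipation_nonneg (t x : ℝ) :
    0 ≤ S.kappa t x * pdx S.θ t x / S.θ t x ^ 2 := by
  have h : S.kappa t x * pdx S.θ t x / S.θ t x ^ 2
      = S.θ t x ^ β * (pdx S.θ t x) ^ 2 / (S.v t x * S.θ t x ^ 2) := by
    unfold kappa; field_simp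
  have h1 := S.v_pos t x
  have h2 := S.θ_pos t x
  rw [h]; positivity

theorem viscous_dissipation_nonneg (t x : ℝ) :
    0 ≤ (pdx S.u t x) ^ 2 / (S.v t x * S.θ t x) := by
  have h1 := S.v_pos t x
  have h2 := S.θ_pos t x
  positivity

theorem phase_dissipation_nonneg (t x : ℝ) :
    0 ≤ S.v t x * (S.mu t x) ^ 2 / S.θ t x := by
  have h1 := S.v_pos t x
  have h2 := S.θ_pos t x
  positivity

theorem w_nonneg (t x : ℝ) : 0 ≤ S.w t x :=
  add_nonneg (add_nonneg (S.heat_dissipation_nonneg t x) (S.viscous_dissipation_nonneg t x))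
    (S.phase_dissipation_nonneg t x)

theorem W_nonneg (t : ℝ) : 0 ≤ S.W t :=
  intervalIntegral.integral_nonneg zero_le_one fun x _ => S.w_nonneg t x

theorem momentum_eq {t x : ℝ} (ht : t ∈ Icc (0:ℝ) T) (hx : x ∈ Icc (0:ℝ) 1) :
    pdt S.u t x = pdx S.sigma t x := S.momentum t ht x hx

theorem phase_eq {t x : ℝ} (ht : t ∈ Icc (0:ℝ) T) (hx : x ∈ Icc (0:ℝ) 1) :
    pdt S.χ t x = -(S.v t x * S.mu t x) := S.phase t ht x hx

theorem temperature_eq {t x : ℝ} (ht : t ∈ Icc (0:ℝ) T) (hx : x ∈ Icc (0:ℝ) 1) :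
    pdt S.θ t x = -((S.θ t x / S.v t x) * pdx S.u t x) + pdx S.kappa t x
      + (pdx S.u t x) ^ 2 / S.v t x + S.v t x * (S.mu t x) ^ 2 := by
  have h : pdt S.θ t x + (S.θ t x / S.v t x) * pdx S.u t x = pdx S.kappa t x
      + (pdx S.u t x) ^ 2 / S.v t x + S.v t x * (S.mu t x) ^ 2 := S.temperature t ht x hx
  linear_combination h

theorem kappa_boundary {t : ℝ} (ht : t ∈ Icc (0:ℝ) T) : S.kappa t 0 = 0 ∧ S.kappa t 1 = 0 := by
  simp [kappa, S.bc_θ t ht]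

theorem q_boundary {t : ℝ} (ht : t ∈ Icc (0:ℝ) T) : S.q t 0 = 0 ∧ S.q t 1 = 0 := by
  simp [q, S.bc_χ t ht]

/-- Conservation of the total volume. -/
theorem integral_v {t : ℝ} (ht : t ∈ Icc (0:ℝ) T) : ∫ x in (0:ℝ)..1, S.v t x = 1 := by
  have h := integral_balance_of_flux_eq (G := fun _ _ => 0) S.smooth_v S.smooth_u
    (SmoothTX.const 0).continuous ht.1 zero_le_one
    (fun s hs x hx => by simpa using S.mass s ⟨hs.1, hs.2.trans ht.2⟩ x hx)
    (fun s hs => by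
      have := S.bc_u s ⟨hs.1, hs.2.trans ht.2⟩
      rw [this.1, this.2])
  simp only [intervalIntegral.integral_zero, S.initial_volume] at h
  linarith

theorem pdt_energy {t x : ℝ} (ht : t ∈ Icc (0:ℝ) T) (hx : x ∈ Icc (0:ℝ) 1) :
    pdt S.energy t x = 0 + pdx (fun t x => S.u t x * S.sigma t x + S.kappa t x
      + S.q t x * pdt S.χ t x) t x := by
  have hv := (S.v_pos t x).ne'
  have hE := (((S.smooth_θ.hasDerivAt_time t x).add
    (((S.smooth_u.hasDerivAt_time t x).pow 2).div_const 2)).add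
    (((((S.smooth_χ.hasDerivAt_time t x).pow 2).sub_const 1).pow 2).div_const 4)).add
    (((S.smooth_χ.pdx.hasDerivAt_time t x).pow 2).div
      ((S.smooth_v.hasDerivAt_time t x).const_mul 2) (mul_ne_zero two_ne_zero hv))
  have hH := (((S.smooth_u.hasDerivAt_space t x).mul (S.smooth_sigma.hasDerivAt_space t x)).add
    (S.smooth_kappa.hasDerivAt_space t x)).add
    ((S.smooth_q.hasDerivAt_space t x).mul (S.smooth_χ.pdt.hasDerivAt_space t x))
  have hE' : pdt S.energy t x = _ := hE.deriv
  have hH' : pdx (fun t x => S.u t x * S.sigma t x + S.kappa t x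
      + S.q t x * pdt S.χ t x) t x = _ := hH.deriv
  rw [hE', hH', ← S.smooth_χ.pdt_pdx_comm, S.momentum_eq ht hx, S.temperature_eq ht hx,
    S.mass t ht x hx]
  have hmu : pdx S.q t x = (S.χ t x) ^ 3 - S.χ t x - S.mu t x := by unfold mu; ring
  have hs : S.sigma t x = pdx S.u t x / S.v t x - S.θ t x / S.v t x
    - (pdx S.χ t x / S.v t x) ^ 2 / 2 := rfl
  have hq : S.q t x = pdx S.χ t x / S.v t x := rfl
  rw [hs, hq, hmu, S.phase_eq ht hx]
  simp only [Pi.pow_apply, Nat.cast_ofNat, Nat.add_one_sub_one, pow_one]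
  field_simp
  ring

/-- Conservation of the total energy. -/
theorem integral_energy {t : ℝ} (ht : t ∈ Icc (0:ℝ) T) :
    ∫ x in (0:ℝ)..1, S.energy t x = 1 := by
  have h := integral_balance_of_flux_eq (G := fun _ _ => 0) S.smooth_energy
    (((S.smooth_u.mul S.smooth_sigma).add S.smooth_kappa).add (S.smooth_q.mul S.smooth_χ.pdt))
    (SmoothTX.const 0).continuous ht.1 zero_le_one
    (fun s hs x hx => S.pdt_energy ⟨hs.1, hs.2.trans ht.2⟩ hx)
    (fun s hs => by
      have hs' : s ∈ Icc 0 T := ⟨hs.1, hs.2.trans ht.2⟩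
      simp [S.bc_u s hs', S.q_boundary hs', S.kappa_boundary hs'])
  have h0 : ∫ x in (0:ℝ)..1, S.energy 0 x = 1 := S.initial_energy
  simp only [intervalIntegral.integral_zero, h0] at h
  linarith

theorem pdt_entropy {t x : ℝ} (ht : t ∈ Icc (0:ℝ) T) (hx : x ∈ Icc (0:ℝ) 1) :
    pdt (fun t x => Real.log (S.v t x) + Real.log (S.θ t x)) t x
      = S.w t x + pdx (fun t x => S.kappa t x / S.θ t x) t x := by
  have hv := (S.v_pos t x).ne'
  have hθ := (S.θ_pos t x).ne'
  have hE := ((S.smooth_v.hasDerivAt_time t x).log hv).add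
    ((S.smooth_θ.hasDerivAt_time t x).log hθ)
  have hH := (S.smooth_kappa.hasDerivAt_space t x).div (S.smooth_θ.hasDerivAt_space t x) hθ
  have hE' : pdt (fun t x => Real.log (S.v t x) + Real.log (S.θ t x)) t x = _ := hE.deriv
  have hH' : pdx (fun t x => S.kappa t x / S.θ t x) t x = _ := hH.deriv
  rw [hE', hH', S.temperature_eq ht hx, S.mass t ht x hx]
  unfold w
  field_simp
  ring

/-- The entropy identity. -/
theorem integral_W_eq {t : ℝ} (ht : t ∈ Icc (0:ℝ) T) :
    ∫ s in (0:ℝ)..t, S.W s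
      = (∫ x in (0:ℝ)..1, (Real.log (S.v t x) + Real.log (S.θ t x)))
        - ∫ x in (0:ℝ)..1, (Real.log (S.v 0 x) + Real.log (S.θ 0 x)) := by
  have h := integral_balance_of_flux_eq
    ((S.smooth_v.log S.v_pos).add (S.smooth_θ.log S.θ_pos))
    (S.smooth_kappa.div S.smooth_θ S.θ_pos)
    S.smooth_w.continuous ht.1 zero_le_one
    (fun s hs x hx => S.pdt_entropy ⟨hs.1, hs.2.trans ht.2⟩ hx)
    (fun s hs => by
      have hs' : s ∈ Icc 0 T := ⟨hs.1, hs.2.trans ht.2⟩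
      simp [S.kappa_boundary hs'])
  exact h.symm

end RegularFlow

theorem intervalIntegral_abs_le_of_sq_le_mul {F G h : ℝ → ℝ} (hh : Continuous h)
    (hF : Continuous F) (hG : Continuous G) (hF0 : ∀ x, 0 ≤ F x) (hG0 : ∀ x, 0 ≤ G x)
    {a b : ℝ} (hab : a ≤ b) (hle : ∀ x ∈ Icc a b, h x ^ 2 ≤ F x * G x) :
    ∫ x in a..b, |h x| ≤ Real.sqrt ((∫ x in a..b, F x) * ∫ x in a..b, G x) := by
  have h1 := intervalIntegral_abs_le_sqrt_mul_sqrt hh hF.sqrt hG.sqrt hab (fun x hx => by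
    rw [← Real.sqrt_mul (hF0 x)]
    exact Real.abs_le_sqrt (hle x hx))
  simp_rw [Real.sq_sqrt (hF0 _), Real.sq_sqrt (hG0 _)] at h1
  rwa [← Real.sqrt_mul (intervalIntegral.integral_nonneg hab fun x _ => hF0 x)] at h1

/-- At a maximum over a closed interval where the derivative vanishes (possibly an endpoint),
the second derivative is nonpositive. -/
theorem second_deriv_nonpos_of_isMaxOn {f f' : ℝ → ℝ} (hf : ∀ x, HasDerivAt f (f' x) x)
    {a b x₀ f'' : ℝ} (hab : a < b) (hx₀ : x₀ ∈ Icc a b) (hmax : ∀ x ∈ Icc a b, f x ≤ f x₀)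
    (h0 : f' x₀ = 0) (hf'' : HasDerivAt f' f'' x₀) : f'' ≤ 0 := by
  by_contra! hpos
  have hsign := eventually_nhdsWithin_sign_eq_of_deriv_pos (f := f') (x₀ := x₀)
    (by rw [hf''.deriv]; exact hpos) h0
  obtain ⟨ε, hε, hball⟩ := Metric.eventually_nhds_iff.1 hsign
  have hcont : Continuous f := continuous_iff_continuousAt.2 fun x => (hf x).continuousAt
  rcases lt_or_eq_of_le hx₀.2 with hlt | heq
  · set y := min b (x₀ + ε / 2) with hy
    have hxy : x₀ < y := lt_min hlt (by linarith)
    have hmono : StrictMonoOn f (Icc x₀ y) := by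
      apply strictMonoOn_of_hasDerivWithinAt_pos (convex_Icc _ _) hcont.continuousOn
        (fun x _ => (hf x).hasDerivWithinAt)
      intro x hx
      rw [interior_Icc] at hx
      have h1 : x < x₀ + ε / 2 := hx.2.trans_le (min_le_right _ _)
      have h2 := hball (y := x) (by rw [Real.dist_eq, abs_lt]; constructor <;> linarith [hx.1])
      rw [sign_pos (sub_pos.2 hx.1)] at h2
      exact sign_eq_one_iff.1 h2
    have := hmono ⟨le_rfl, hxy.le⟩ ⟨hxy.le, le_rfl⟩ hxy
    have := hmax y ⟨hx₀.1.trans hxy.le, min_le_left _ _⟩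
    linarith
  · have hlt : a < x₀ := by rw [heq]; exact hab
    set y := max a (x₀ - ε / 2) with hy
    have hxy : y < x₀ := max_lt hlt (by linarith)
    have hmono : StrictAntiOn f (Icc y x₀) := by
      apply strictAntiOn_of_hasDerivWithinAt_neg (convex_Icc _ _) hcont.continuousOn
        (fun x _ => (hf x).hasDerivWithinAt)
      intro x hx
      rw [interior_Icc] at hx
      have h1 : x₀ - ε / 2 < x := (le_max_right _ _).trans_lt hx.1
      have h2 := hball (y := x) (by rw [Real.dist_eq, abs_lt]; constructor <;> linarith [hx.2])
      rw [sign_neg (sub_neg.2 hx.2)] at h2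
      exact sign_eq_neg_one_iff.1 h2
    have := hmono ⟨le_rfl, hxy.le⟩ ⟨hxy.le, le_rfl⟩ hxy
    have := hmax y ⟨le_max_left _ _, hxy.le.trans hx₀.2⟩
    linarith

/-- The derivative at a point that is maximal among earlier times is nonnegative. -/
theorem deriv_nonneg_of_le_left {f : ℝ → ℝ} {a t f' : ℝ} (hat : a < t)
    (hf : HasDerivAt f f' t) (hmax : ∀ s ∈ Icc a t, f s ≤ f t) : 0 ≤ f' := by
  by_contra! hneg
  have h := (hasDerivAt_iff_tendsto_slope_left_right.1 hf).1
  have h2 := (h.eventually (gt_mem_nhds hneg)).and (Ioo_mem_nhdsLT hat)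
  obtain ⟨s, hs, hs'⟩ := h2.exists
  have h3 := hmax s ⟨hs'.1.le, hs'.2.le⟩
  rw [slope_def_field, div_neg_iff] at hs
  rcases hs with hs | hs <;> linarith [hs'.2]

namespace RegularFlow

variable {β T V₀ R : ℝ} (S : RegularFlow β T V₀ R)

/-- The maximum principle for the phase field. -/
theorem χ_le_one {t x : ℝ} (ht : t ∈ Icc (0:ℝ) T) (hx : x ∈ Icc (0:ℝ) 1) : S.χ t x ≤ 1 := by
  obtain ⟨⟨t₀, x₀⟩, ⟨ht₀, hx₀⟩, hmax⟩ := (isCompact_Icc.prod isCompact_Icc).exists_isMaxOn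
    (⟨(t, x), ht, hx⟩ : (Icc (0:ℝ) T ×ˢ Icc (0:ℝ) 1).Nonempty) S.smooth_χ.continuous.continuousOn
  have hmax' : ∀ s ∈ Icc (0:ℝ) T, ∀ y ∈ Icc (0:ℝ) 1, S.χ s y ≤ S.χ t₀ x₀ :=
    fun s hs y hy => hmax (show (s, y) ∈ Icc (0:ℝ) T ×ˢ Icc (0:ℝ) 1 from ⟨hs, hy⟩)
  simp only at ht₀ hx₀
  refine (hmax' t ht x hx).trans ?_
  by_contra! hgt
  have ht₀pos : 0 < t₀ := by
    rcases lt_or_eq_of_le ht₀.1 with h | h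
    · exact h
    · rw [← h] at hgt
      linarith [S.initial_χ_le x₀ hx₀]
  have htime : 0 ≤ pdt S.χ t₀ x₀ :=
    deriv_nonneg_of_le_left ht₀pos (S.smooth_χ.hasDerivAt_time t₀ x₀)
      fun s hs => hmax' s ⟨hs.1, hs.2.trans ht₀.2⟩ x₀ hx₀
  have hgrad : pdx S.χ t₀ x₀ = 0 := by
    rcases eq_or_lt_of_le hx₀.1 with h | h
    · rw [← h]; exact (S.bc_χ t₀ ht₀).1
    rcases eq_or_lt_of_le hx₀.2 with h' | h'
    · rw [h']; exact (S.bc_χ t₀ ht₀).2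
    have hloc : IsLocalMax (S.χ t₀) x₀ := by
      filter_upwards [Icc_mem_nhds h h'] with y hy using hmax' t₀ ht₀ y hy
    exact hloc.deriv_eq_zero
  have hsecond : pdx (pdx S.χ) t₀ x₀ ≤ 0 :=
    second_deriv_nonpos_of_isMaxOn (fun y => S.smooth_χ.hasDerivAt_space t₀ y) zero_lt_one hx₀
      (fun y hy => hmax' t₀ ht₀ y hy) hgrad (S.smooth_χ.pdx.hasDerivAt_space t₀ x₀)
  have hv := S.v_pos t₀ x₀
  have hq : pdx S.q t₀ x₀ = pdx (pdx S.χ) t₀ x₀ / S.v t₀ x₀ := by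
    have h1 := (S.smooth_χ.pdx.hasDerivAt_space t₀ x₀).div
      (S.smooth_v.hasDerivAt_space t₀ x₀) hv.ne'
    have h2 : pdx S.q t₀ x₀ = _ := h1.deriv
    rw [h2, hgrad]
    field_simp
    ring
  have heq := S.phase_eq ht₀ hx₀
  have hmu : S.v t₀ x₀ * S.mu t₀ x₀ = -(pdx (pdx S.χ) t₀ x₀)
      + S.v t₀ x₀ * ((S.χ t₀ x₀) ^ 3 - S.χ t₀ x₀) := by
    unfold mu
    rw [hq]
    field_simp
  have hcubic : 0 < (S.χ t₀ x₀) ^ 3 - S.χ t₀ x₀ := by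
    nlinarith [mul_pos (sub_pos.2 hgt) (zero_lt_one.trans hgt)]
  have := mul_pos hv hcubic
  linarith

theorem energy_terms_nonneg (t x : ℝ) :
    0 ≤ (S.u t x) ^ 2 / 2 ∧ 0 ≤ ((S.χ t x) ^ 2 - 1) ^ 2 / 4
      ∧ 0 ≤ (pdx S.χ t x) ^ 2 / (2 * S.v t x) := by
  have := S.v_pos t x
  refine ⟨by positivity, by positivity, by positivity⟩

theorem integral_θ_le {t : ℝ} (ht : t ∈ Icc (0:ℝ) T) : ∫ x in (0:ℝ)..1, S.θ t x ≤ 1 := by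
  refine le_of_le_of_eq ?_ (S.integral_energy ht)
  apply intervalIntegral.integral_mono_on zero_le_one
    ((S.smooth_θ.continuous_space t).intervalIntegrable _ _)
    ((S.smooth_energy.continuous_space t).intervalIntegrable _ _)
  intro x _
  obtain ⟨h1, h2, h3⟩ := S.energy_terms_nonneg t x
  unfold energy; linarith

theorem integral_u_sq_le {t : ℝ} (ht : t ∈ Icc (0:ℝ) T) :
    ∫ x in (0:ℝ)..1, S.u t x ^ 2 ≤ 2 := by
  have h : ∫ x in (0:ℝ)..1, S.u t x ^ 2 ≤ ∫ x in (0:ℝ)..1, 2 * S.energy t x := by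
    apply intervalIntegral.integral_mono_on zero_le_one
      (((S.smooth_u.pow 2).continuous_space t).intervalIntegrable _ _)
      (((S.smooth_energy.continuous_space t).const_mul 2).intervalIntegrable _ _)
    intro x _
    obtain ⟨h1, h2, h3⟩ := S.energy_terms_nonneg t x
    have := S.θ_pos t x
    unfold energy; linarith
  rw [intervalIntegral.integral_const_mul, S.integral_energy ht] at h
  linarith

theorem zero_mem (S : RegularFlow β T V₀ R) : (0:ℝ) ∈ Icc (0:ℝ) T := ⟨le_rfl, S.T_nonneg⟩

theorem V₀_le_one (S : RegularFlow β T V₀ R) : V₀ ≤ 1 := by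
  have h : ∫ _ in (0:ℝ)..1, V₀ ≤ ∫ x in (0:ℝ)..1, S.v 0 x :=
    intervalIntegral.integral_mono_on zero_le_one (by simp)
      ((S.smooth_v.continuous_space 0).intervalIntegrable _ _) S.initial_v_ge
  rw [S.initial_volume] at h
  simpa using h

theorem log_V₀_nonpos (S : RegularFlow β T V₀ R) : Real.log V₀ ≤ 0 :=
  Real.log_nonpos S.V₀_pos.le S.V₀_le_one

theorem initial_entropy_ge :
    2 * Real.log V₀ ≤ ∫ x in (0:ℝ)..1, (Real.log (S.v 0 x) + Real.log (S.θ 0 x)) := by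
  have h : ∫ _ in (0:ℝ)..1, 2 * Real.log V₀
      ≤ ∫ x in (0:ℝ)..1, (Real.log (S.v 0 x) + Real.log (S.θ 0 x)) := by
    apply intervalIntegral.integral_mono_on zero_le_one (by simp)
      ((((S.smooth_v.log S.v_pos).add (S.smooth_θ.log S.θ_pos)).continuous_space
        0).intervalIntegrable _ _)
    intro x hx
    have h1 := Real.log_le_log S.V₀_pos (S.initial_v_ge x hx)
    have h2 := Real.log_le_log S.V₀_pos (S.initial_θ_ge x hx)
    linarith
  simpa using h

theorem integral_log_v_le {t : ℝ} (ht : t ∈ Icc (0:ℝ) T) :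
    ∫ x in (0:ℝ)..1, Real.log (S.v t x) ≤ 0 := by
  have hc := S.smooth_v.continuous_space t
  have h : ∫ x in (0:ℝ)..1, Real.log (S.v t x) ≤ ∫ x in (0:ℝ)..1, (S.v t x - 1) :=
    intervalIntegral.integral_mono_on zero_le_one
      (((S.smooth_v.log S.v_pos).continuous_space t).intervalIntegrable _ _)
      ((hc.sub continuous_const).intervalIntegrable _ _)
      fun x _ => Real.log_le_sub_one_of_pos (S.v_pos t x)
  rw [intervalIntegral.integral_sub (hc.intervalIntegrable _ _) (by simp), S.integral_v ht] at h
  simpa using h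

theorem integral_log_θ_ge {t : ℝ} (ht : t ∈ Icc (0:ℝ) T) :
    2 * Real.log V₀ + (∫ s in (0:ℝ)..t, S.W s) ≤ ∫ x in (0:ℝ)..1, Real.log (S.θ t x) := by
  have h := S.integral_W_eq ht
  rw [intervalIntegral.integral_add
    (((S.smooth_v.log S.v_pos).continuous_space t).intervalIntegrable _ _)
    (((S.smooth_θ.log S.θ_pos).continuous_space t).intervalIntegrable _ _)] at h
  linarith [S.integral_log_v_le ht, S.initial_entropy_ge]

theorem integral_θ_pos (t : ℝ) : 0 < ∫ x in (0:ℝ)..1, S.θ t x :=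
  intervalIntegral.intervalIntegral_pos_of_pos_on
    ((S.smooth_θ.continuous_space t).intervalIntegrable _ _) (fun x _ => S.θ_pos t x) zero_lt_one

theorem integral_log_θ_le (t : ℝ) :
    ∫ x in (0:ℝ)..1, Real.log (S.θ t x) ≤ Real.log (∫ x in (0:ℝ)..1, S.θ t x) := by
  have hm := S.integral_θ_pos t
  set m := ∫ x in (0:ℝ)..1, S.θ t x with hmdef
  have hc := S.smooth_θ.continuous_space t
  have hc' : Continuous (fun x => S.θ t x / m + (Real.log m - 1)) :=
    (hc.div_const m).add continuous_const
  have h : ∫ x in (0:ℝ)..1, Real.log (S.θ t x)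
      ≤ ∫ x in (0:ℝ)..1, (S.θ t x / m + (Real.log m - 1)) := by
    apply intervalIntegral.integral_mono_on zero_le_one
      (((S.smooth_θ.log S.θ_pos).continuous_space t).intervalIntegrable _ _)
      (hc'.intervalIntegrable _ _)
    intro x _
    have h1 := Real.log_le_sub_one_of_pos (div_pos (S.θ_pos t x) hm)
    rw [Real.log_div (S.θ_pos t x).ne' hm.ne'] at h1
    linarith
  rw [intervalIntegral.integral_add ((hc.div_const m).intervalIntegrable _ _) (by simp),
    intervalIntegral.integral_div, ← hmdef, div_self hm.ne'] at h
  simpa using h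

theorem integral_W_le {t : ℝ} (ht : t ∈ Icc (0:ℝ) T) :
    ∫ s in (0:ℝ)..t, S.W s ≤ -2 * Real.log V₀ := by
  have h1 := S.integral_log_θ_ge ht
  have h2 := S.integral_log_θ_le t
  have h3 := Real.log_nonpos (S.integral_θ_pos t).le (S.integral_θ_le ht)
  linarith

theorem integral_θ_ge {t : ℝ} (ht : t ∈ Icc (0:ℝ) T) : V₀ ^ 2 ≤ ∫ x in (0:ℝ)..1, S.θ t x := by
  have h1 := S.integral_log_θ_ge ht
  have h2 := S.integral_log_θ_le t
  have h3 : 0 ≤ ∫ s in (0:ℝ)..t, S.W s :=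
    intervalIntegral.integral_nonneg ht.1 fun s _ => S.W_nonneg s
  rw [← Real.log_le_log_iff (pow_pos S.V₀_pos 2) (S.integral_θ_pos t), Real.log_pow]
  push_cast
  linarith

theorem continuous_heat_dissipation (t : ℝ) :
    Continuous (fun x => S.kappa t x * pdx S.θ t x / S.θ t x ^ 2) :=
  ((S.smooth_kappa.mul S.smooth_θ.pdx).div (S.smooth_θ.pow 2)
      fun t x => pow_pos (S.θ_pos t x) 2).continuous_space t

theorem continuous_phase_dissipation (t : ℝ) :
    Continuous (fun x => S.v t x * (S.mu t x) ^ 2 / S.θ t x) :=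
  ((S.smooth_v.mul (S.smooth_mu.pow 2)).div S.smooth_θ S.θ_pos).continuous_space t

theorem integral_heat_dissipation_le (t : ℝ) :
    ∫ x in (0:ℝ)..1, S.kappa t x * pdx S.θ t x / S.θ t x ^ 2 ≤ S.W t := by
  apply intervalIntegral.integral_mono_on zero_le_one
    ((S.continuous_heat_dissipation t).intervalIntegrable _ _)
    ((S.smooth_w.continuous_space t).intervalIntegrable _ _)
  intro x _
  have h1 := S.viscous_dissipation_nonneg t x
  have h2 := S.phase_dissipation_nonneg t x
  unfold w; linarith

theorem integral_phase_dissipation_le (t : ℝ) :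
    ∫ x in (0:ℝ)..1, S.v t x * (S.mu t x) ^ 2 / S.θ t x ≤ S.W t := by
  apply intervalIntegral.integral_mono_on zero_le_one
    ((S.continuous_phase_dissipation t).intervalIntegrable _ _)
    ((S.smooth_w.continuous_space t).intervalIntegrable _ _)
  intro x _
  have h1 := S.viscous_dissipation_nonneg t x
  have h2 := S.heat_dissipation_nonneg t x
  unfold w; linarith

/-- The oscillation of `θ^(β/2)` is controlled by the entropy production. -/
theorem θ_rpow_oscillation (hβ : 0 < β) {t x y : ℝ} (ht : t ∈ Icc (0:ℝ) T)
    (hx : x ∈ Icc (0:ℝ) 1) (hy : y ∈ Icc (0:ℝ) 1) :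
    |S.θ t y ^ (β / 2) - S.θ t x ^ (β / 2)| ≤ β / 2 * Real.sqrt (S.W t) := by
  have hd : ∀ z, HasDerivAt (fun z => S.θ t z ^ (β / 2))
      (β / 2 * (pdx S.θ t z * S.θ t z ^ (β / 2 - 1))) z := fun z => by
    have := (S.smooth_θ.hasDerivAt_space t z).rpow_const (p := β / 2) (Or.inl (S.θ_pos t z).ne')
    convert this using 1; ring
  have hc : Continuous (fun z => pdx S.θ t z * S.θ t z ^ (β / 2 - 1)) :=
    (S.smooth_θ.pdx.mul (S.smooth_θ.rpow_const S.θ_pos (β / 2 - 1))).continuous_space t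
  have h1 := abs_sub_le_integral_abs_deriv_unit hd (hc.const_mul (β / 2)) hx hy
  have h2 := intervalIntegral_abs_le_of_sq_le_mul hc (S.continuous_heat_dissipation t)
    (S.smooth_v.continuous_space t) (S.heat_dissipation_nonneg t) (fun z => (S.v_pos t z).le)
    (zero_le_one (α := ℝ)) (fun z _ => by
      have hθ := S.θ_pos t z
      have hv := S.v_pos t z
      have h3 : (S.θ t z ^ (β / 2 - 1)) ^ 2 = S.θ t z ^ β / S.θ t z ^ 2 := by
        rw [← Real.rpow_natCast, ← Real.rpow_mul hθ.le, ← Real.rpow_natCast,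
          ← Real.rpow_sub hθ]
        congr 1; push_cast; ring
      rw [mul_pow, h3]
      unfold kappa
      apply le_of_eq
      field_simp)
  rw [S.integral_v ht, mul_one] at h2
  have h3 : ∫ z in (0:ℝ)..1, |β / 2 * (pdx S.θ t z * S.θ t z ^ (β / 2 - 1))|
      = β / 2 * ∫ z in (0:ℝ)..1, |pdx S.θ t z * S.θ t z ^ (β / 2 - 1)| := by
    rw [← intervalIntegral.integral_const_mul]
    simp_rw [abs_mul (β / 2), abs_of_pos (half_pos hβ)]
  rw [h3] at h1
  refine h1.trans (mul_le_mul_of_nonneg_left (h2.trans ?_) (half_pos hβ).le)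
  exact Real.sqrt_le_sqrt (S.integral_heat_dissipation_le t)

/-- A pointwise lower bound for the temperature, nontrivial when entropy production is small. -/
theorem θ_ge (hβ : 0 < β) {t x : ℝ} (ht : t ∈ Icc (0:ℝ) T) (hx : x ∈ Icc (0:ℝ) 1) :
    (V₀ ^ β / 2) ^ (2 / β) * (1 - S.W t / (V₀ ^ β / β) ^ 2) ≤ S.θ t x := by
  have hV := S.V₀_pos
  have hVβ : 0 < V₀ ^ β := Real.rpow_pos_of_pos hV β
  have hθ := S.θ_pos t x
  have hW := S.W_nonneg t
  have hc : 0 < (V₀ ^ β / 2) ^ (2 / β) := by positivity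
  rcases le_total ((V₀ ^ β / β) ^ 2) (S.W t) with hbig | hsmall
  · have : 1 ≤ S.W t / (V₀ ^ β / β) ^ 2 := by rwa [one_le_div (by positivity)]
    nlinarith
  · obtain ⟨a, ha, hθa⟩ := exists_ge_unit_integral (S.smooth_θ.continuous_space t)
    have hθa' : V₀ ^ 2 ≤ S.θ t a := (S.integral_θ_ge ht).trans hθa
    have h1 := abs_le.1 (S.θ_rpow_oscillation hβ ht ha hx)
    have h2 : V₀ ^ β ≤ S.θ t a ^ (β / 2) := by
      have := Real.rpow_le_rpow (by positivity) hθa' (half_pos hβ).le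
      rwa [← Real.rpow_natCast, ← Real.rpow_mul hV.le,
        show ((2:ℕ):ℝ) * (β / 2) = β by push_cast; ring] at this
    have h3 : Real.sqrt (S.W t) ≤ V₀ ^ β / β :=
      Real.sqrt_le_iff.2 ⟨by positivity, hsmall⟩
    have h4 : β / 2 * Real.sqrt (S.W t) ≤ V₀ ^ β / 2 := by
      calc β / 2 * Real.sqrt (S.W t) ≤ β / 2 * (V₀ ^ β / β) := by gcongr
        _ = V₀ ^ β / 2 := by field_simp
    have h5 : V₀ ^ β / 2 ≤ S.θ t x ^ (β / 2) := by linarith [h1.1]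
    have h6 := Real.rpow_le_rpow (by positivity) h5 (show 0 ≤ 2 / β by positivity)
    rw [← Real.rpow_mul hθ.le, show β / 2 * (2 / β) = 1 by field_simp, Real.rpow_one] at h6
    have h7 : 0 ≤ S.W t / (V₀ ^ β / β) ^ 2 := by positivity
    nlinarith

theorem sqrt_θ_oscillation (hβ : 0 < β) {t a b M : ℝ} (ht : t ∈ Icc (0:ℝ) T) (ha : 0 ≤ a)
    (hab : a ≤ b) (hb : b ≤ 1) (hM : ∀ y ∈ Icc (0:ℝ) 1, S.v t y ≤ M)
    (hone : ∀ y ∈ Icc a b, 1 ≤ S.θ t y) :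
    |Real.sqrt (S.θ t b) - Real.sqrt (S.θ t a)| ≤ Real.sqrt (S.W t * (M / 4)) := by
  have hd : ∀ z, HasDerivAt (fun z => Real.sqrt (S.θ t z))
      (pdx S.θ t z / (2 * Real.sqrt (S.θ t z))) z := fun z =>
    (S.smooth_θ.hasDerivAt_space t z).sqrt (S.θ_pos t z).ne'
  have hθc := S.smooth_θ.continuous_space t
  have hvc := S.smooth_v.continuous_space t
  have hc : Continuous (fun z => pdx S.θ t z / (2 * Real.sqrt (S.θ t z))) :=
    (S.smooth_θ.pdx.continuous_space t).div (hθc.sqrt.const_mul 2)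
      fun z => (mul_pos two_pos (Real.sqrt_pos.2 (S.θ_pos t z))).ne'
  have hvθ : Continuous (fun z => S.v t z * S.θ t z / 4) := (hvc.mul hθc).div_const 4
  have hvθ0 : ∀ z, 0 ≤ S.v t z * S.θ t z / 4 := fun z => by
    have h1 := S.v_pos t z
    have h2 := S.θ_pos t z
    positivity
  have h1 := abs_sub_le_integral_abs_deriv hd hc hab
  have h2 := intervalIntegral_abs_le_of_sq_le_mul hc (S.continuous_heat_dissipation t)
    hvθ (S.heat_dissipation_nonneg t) hvθ0 hab (fun z hz => by
      have hθ := S.θ_pos t z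
      have hv := S.v_pos t z
      have h3 : 1 ≤ S.θ t z ^ β := Real.one_le_rpow (hone z hz) hβ.le
      rw [div_pow, mul_pow, Real.sq_sqrt hθ.le]
      have h4 : S.kappa t z * pdx S.θ t z / S.θ t z ^ 2 * (S.v t z * S.θ t z / 4)
          = S.θ t z ^ β * ((pdx S.θ t z) ^ 2 / (2 ^ 2 * S.θ t z)) := by
        unfold kappa; field_simp; norm_num
      rw [h4]
      exact le_mul_of_one_le_left (by positivity) h3)
  refine h1.trans (h2.trans (Real.sqrt_le_sqrt ?_))
  have h5 : ∫ z in a..b, S.kappa t z * pdx S.θ t z / S.θ t z ^ 2 ≤ S.W t :=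
    (intervalIntegral_mono_interval_of_nonneg (S.continuous_heat_dissipation t) ha hab hb
      fun z _ => S.heat_dissipation_nonneg t z).trans (S.integral_heat_dissipation_le t)
  have h6 : ∫ z in a..b, S.v t z * S.θ t z / 4 ≤ M / 4 := by
    have hM0 : 0 ≤ M := (S.v_pos t 0).le.trans (hM 0 ⟨le_rfl, zero_le_one⟩)
    calc ∫ z in a..b, S.v t z * S.θ t z / 4 ≤ ∫ z in (0:ℝ)..1, S.v t z * S.θ t z / 4 :=
          intervalIntegral_mono_interval_of_nonneg hvθ ha hab hb fun z _ => hvθ0 z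
      _ ≤ ∫ z in (0:ℝ)..1, M / 4 * S.θ t z := by
          apply intervalIntegral.integral_mono_on zero_le_one (hvθ.intervalIntegrable _ _)
            ((hθc.const_mul _).intervalIntegrable _ _)
          intro z hz
          have := mul_le_mul_of_nonneg_right (hM z hz) (S.θ_pos t z).le
          linarith
      _ = M / 4 * ∫ z in (0:ℝ)..1, S.θ t z := intervalIntegral.integral_const_mul _ _
      _ ≤ M / 4 * 1 := mul_le_mul_of_nonneg_left (S.integral_θ_le ht) (by positivity)
      _ = M / 4 := mul_one _
  exact mul_le_mul h5 h6 (intervalIntegral.integral_nonneg hab fun z _ => hvθ0 z) (S.W_nonneg t)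

/-- A pointwise upper bound for the temperature. -/
theorem θ_le (hβ : 0 < β) {t x M : ℝ} (ht : t ∈ Icc (0:ℝ) T) (hx : x ∈ Icc (0:ℝ) 1)
    (hM : ∀ y ∈ Icc (0:ℝ) 1, S.v t y ≤ M) : S.θ t x ≤ 2 + S.W t * M / 2 := by
  have hW := S.W_nonneg t
  have hM0 : 0 ≤ M := (S.v_pos t 0).le.trans (hM 0 ⟨le_rfl, zero_le_one⟩)
  have hθc := S.smooth_θ.continuous_space t
  rcases le_total (S.θ t x) 1 with h1 | h1
  · have : 0 ≤ S.W t * M := mul_nonneg hW hM0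
    linarith
  have key : |Real.sqrt (S.θ t x) - 1| ≤ Real.sqrt (S.W t * (M / 4)) := by
    obtain ⟨a, ha, hθa⟩ := exists_le_unit_integral hθc
    have hθa' : S.θ t a ≤ 1 := hθa.trans (S.integral_θ_le ht)
    rcases le_total a x with hax | hax
    · obtain ⟨b, hb, hb1, hone⟩ := exists_last_eq_one hθc hax hθa' h1
      have := S.sqrt_θ_oscillation hβ ht (ha.1.trans hb.1) hb.2 hx.2 hM hone
      rwa [hb1, Real.sqrt_one] at this
    · obtain ⟨b, hb, hb1, hone⟩ := exists_first_eq_one hθc hax hθa' h1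
      have := S.sqrt_θ_oscillation hβ ht hx.1 hb.1 (hb.2.trans ha.2) hM hone
      rwa [hb1, Real.sqrt_one, abs_sub_comm] at this
  have h2 := (abs_le.1 key).2
  have h3 := Real.sq_sqrt (S.θ_pos t x).le
  have h4 := Real.sq_sqrt (show 0 ≤ S.W t * (M / 4) by positivity)
  have h5 := Real.sqrt_nonneg (S.θ t x)
  have h6 := Real.sqrt_nonneg (S.W t * (M / 4))
  nlinarith [sq_nonneg (Real.sqrt (S.W t * (M / 4)) - 1)]

/-- The phase gradient is controlled by the entropy production. -/
theorem q_sq_le {t x m : ℝ} (ht : t ∈ Icc (0:ℝ) T) (hx : x ∈ Icc (0:ℝ) 1) (hm : 0 < m)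
    (hv : ∀ y ∈ Icc (0:ℝ) 1, m ≤ S.v t y) : S.q t x ^ 2 ≤ 4 * S.W t / m := by
  have hqc := S.smooth_q.pdx.continuous_space t
  have hmc := S.smooth_mu.continuous_space t
  have hχc := S.smooth_χ.continuous_space t
  have hcub : Continuous (fun y => S.χ t y - S.χ t y ^ 3) := hχc.sub (hχc.pow 3)
  have hcubneg : Continuous (fun y => -(S.χ t y - S.χ t y ^ 3)) := hcub.neg
  have hsum : Continuous (fun y => (S.χ t y - S.χ t y ^ 3) + |S.mu t y|) := hcub.add hmc.abs
  have hqx : ∀ y, pdx S.q t y = -(S.χ t y - S.χ t y ^ 3) - S.mu t y := fun y => by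
    unfold mu; ring
  have h0 : ∫ y in (0:ℝ)..1, pdx S.q t y = 0 := by
    rw [intervalIntegral.integral_eq_sub_of_hasDerivAt
      (fun y _ => S.smooth_q.hasDerivAt_space t y) (hqc.intervalIntegrable _ _),
      (S.q_boundary ht).1, (S.q_boundary ht).2, sub_zero]
  have hcubic : ∫ y in (0:ℝ)..1, (S.χ t y - S.χ t y ^ 3) ≤ ∫ y in (0:ℝ)..1, |S.mu t y| := by
    simp_rw [hqx] at h0
    rw [intervalIntegral.integral_sub (hcubneg.intervalIntegrable _ _)
      (hmc.intervalIntegrable _ _), intervalIntegral.integral_neg] at h0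
    have := neg_le_of_abs_le
      (intervalIntegral.abs_integral_le_integral_abs (f := S.mu t) (μ := volume)
        (zero_le_one (α := ℝ)))
    linarith
  have hq : |S.q t x| ≤ 2 * ∫ y in (0:ℝ)..1, |S.mu t y| := by
    have h1 := abs_sub_le_integral_abs_deriv_unit (fun y => S.smooth_q.hasDerivAt_space t y)
      hqc ⟨le_rfl, zero_le_one⟩ hx
    rw [(S.q_boundary ht).1, sub_zero] at h1
    have h2 : ∫ y in (0:ℝ)..1, |pdx S.q t y|
        ≤ ∫ y in (0:ℝ)..1, ((S.χ t y - S.χ t y ^ 3) + |S.mu t y|) := by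
      apply intervalIntegral.integral_mono_on zero_le_one (hqc.abs.intervalIntegrable _ _)
        (hsum.intervalIntegrable _ _)
      intro y hy
      have hχ0 := S.χ_pos t ht y hy
      have hχ1 := S.χ_le_one ht hy
      have hnn : 0 ≤ S.χ t y - S.χ t y ^ 3 := by
        have : S.χ t y - S.χ t y ^ 3 = S.χ t y * ((1 - S.χ t y) * (1 + S.χ t y)) := by ring
        rw [this]
        exact mul_nonneg hχ0.le (mul_nonneg (by linarith) (by linarith))
      rw [hqx]
      refine (abs_sub _ _).trans ?_
      rw [abs_neg, abs_of_nonneg hnn]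
    rw [intervalIntegral.integral_add (hcub.intervalIntegrable _ _)
      (hmc.abs.intervalIntegrable _ _)] at h2
    linarith
  have hθv : Continuous (fun y => S.θ t y / S.v t y) :=
    (S.smooth_θ.div S.smooth_v S.v_pos).continuous_space t
  have hθv0 : ∀ y, 0 ≤ S.θ t y / S.v t y := fun y =>
    div_nonneg (S.θ_pos t y).le (S.v_pos t y).le
  have hmuint := intervalIntegral_abs_le_of_sq_le_mul hmc (S.continuous_phase_dissipation t)
    hθv (S.phase_dissipation_nonneg t) hθv0 (zero_le_one (α := ℝ)) (fun y _ => by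
      have h1 := S.v_pos t y
      have h2 := S.θ_pos t y
      apply le_of_eq
      field_simp)
  have hθvint : ∫ y in (0:ℝ)..1, S.θ t y / S.v t y ≤ 1 / m := by
    calc ∫ y in (0:ℝ)..1, S.θ t y / S.v t y ≤ ∫ y in (0:ℝ)..1, S.θ t y / m := by
          apply intervalIntegral.integral_mono_on zero_le_one (hθv.intervalIntegrable _ _)
            (((S.smooth_θ.continuous_space t).div_const m).intervalIntegrable _ _)
          intro y hy
          exact div_le_div_of_nonneg_left (S.θ_pos t y).le hm (hv y hy)
      _ = (∫ y in (0:ℝ)..1, S.θ t y) / m := intervalIntegral.integral_div _ _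
      _ ≤ 1 / m := div_le_div_of_nonneg_right (S.integral_θ_le ht) hm.le
  have hprod : (∫ y in (0:ℝ)..1, S.v t y * S.mu t y ^ 2 / S.θ t y)
      * (∫ y in (0:ℝ)..1, S.θ t y / S.v t y) ≤ S.W t * (1 / m) :=
    mul_le_mul (S.integral_phase_dissipation_le t) hθvint
      (intervalIntegral.integral_nonneg zero_le_one fun y _ => hθv0 y) (S.W_nonneg t)
  have hfinal : |S.q t x| ≤ 2 * Real.sqrt (S.W t * (1 / m)) :=
    hq.trans (mul_le_mul_of_nonneg_left (hmuint.trans (Real.sqrt_le_sqrt hprod)) zero_le_two)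
  calc S.q t x ^ 2 = |S.q t x| ^ 2 := (sq_abs _).symm
    _ ≤ (2 * Real.sqrt (S.W t * (1 / m))) ^ 2 := by gcongr
    _ = 4 * (S.W t * (1 / m)) := by
        rw [mul_pow, Real.sq_sqrt (mul_nonneg (S.W_nonneg t) (by positivity))]; norm_num
    _ = 4 * S.W t / m := by ring

end RegularFlow

/-! ### The representation of the specific volume -/

namespace RegularFlow

variable {β T V₀ R : ℝ} (S : RegularFlow β T V₀ R)

/-- The velocity potential `∫₀ˣ u`. -/
def potential : ℝ → ℝ → ℝ := fun t x => ∫ y in (0:ℝ)..x, S.u t y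

/-- The average of the velocity potential, weighted by the specific volume. -/
def meanPotential : ℝ → ℝ := fun t => ∫ x in (0:ℝ)..1, S.v t x * S.potential t x

/-- The density of the mean pressure. -/
def pressureDensity : ℝ → ℝ → ℝ := fun t x =>
  S.θ t x + (S.u t x) ^ 2 + (pdx S.χ t x) ^ 2 / (2 * S.v t x)

/-- The mean pressure. -/
def meanPressure : ℝ → ℝ := fun t => ∫ x in (0:ℝ)..1, S.pressureDensity t x

/-- The source term in the representation of the specific volume. -/
def source : ℝ → ℝ → ℝ := fun t x => S.θ t x + S.v t x * (S.q t x) ^ 2 / 2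

theorem smooth_pressureDensity : SmoothTX S.pressureDensity :=
  (S.smooth_θ.add (S.smooth_u.pow 2)).add ((S.smooth_χ.pdx.pow 2).div
    ((SmoothTX.const 2).mul S.smooth_v) fun t x => mul_pos two_pos (S.v_pos t x))

theorem smooth_source : SmoothTX S.source :=
  S.smooth_θ.add ((S.smooth_v.mul (S.smooth_q.pow 2)).div (SmoothTX.const 2)
    fun _ _ => two_pos)

theorem continuous_potential : Continuous (fun p : ℝ × ℝ => S.potential p.1 p.2) :=
  intervalIntegral.continuous_parametric_intervalIntegral_of_continuous
    (f := fun (p : ℝ × ℝ) y => S.u p.1 y)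
    (S.smooth_u.continuous.comp
      ((continuous_fst.comp continuous_fst).prodMk continuous_snd)) continuous_snd

theorem continuous_potential_space (t : ℝ) : Continuous (S.potential t) :=
  S.continuous_potential.comp (Continuous.prodMk_right t)

theorem continuous_potential_time (x : ℝ) : Continuous (fun t => S.potential t x) :=
  S.continuous_potential.comp (Continuous.prodMk_left x)

theorem continuous_meanPotential : Continuous S.meanPotential :=
  continuous_intervalIntegral_space (f := fun t x => S.v t x * S.potential t x)
    (S.smooth_v.continuous.mul S.continuous_potential) 0 1

theorem continuous_meanPressure : Continuous S.meanPressure :=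
  continuous_intervalIntegral_space S.smooth_pressureDensity.continuous 0 1

theorem hasDerivAt_potential_space (t x : ℝ) : HasDerivAt (S.potential t) (S.u t x) x :=
  ((S.smooth_u.continuous_space t).integral_hasStrictDerivAt 0 x).hasDerivAt

theorem potential_sub {t x : ℝ} (ht : t ∈ Icc (0:ℝ) T) (hx : x ∈ Icc (0:ℝ) 1) :
    S.potential t x - S.potential 0 x
      = ∫ s in (0:ℝ)..t, (S.sigma s x - S.sigma s 0) := by
  have h := integral_balance (G := fun _ _ => 0) S.smooth_u S.smooth_sigma
    (SmoothTX.const 0).continuous ht.1 hx.1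
    (fun s hs y hy => by
      rw [zero_add]
      exact S.momentum_eq ⟨hs.1, hs.2.trans ht.2⟩ ⟨hy.1, hy.2.trans hx.2⟩)
  simp only [intervalIntegral.integral_zero, zero_add] at h
  exact h

theorem hasDerivAt_potential_time {t x : ℝ} (ht : t ∈ Ioo (0:ℝ) T) (hx : x ∈ Icc (0:ℝ) 1) :
    HasDerivAt (fun s => S.potential s x) (S.sigma t x - S.sigma t 0) t := by
  have hc : Continuous (fun s => S.sigma s x - S.sigma s 0) :=
    (S.smooth_sigma.continuous_time x).sub (S.smooth_sigma.continuous_time 0)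
  refine ((hc.integral_hasStrictDerivAt 0 t).hasDerivAt.const_add
    (S.potential 0 x)).congr_of_eventuallyEq ?_
  filter_upwards [Ioo_mem_nhds ht.1 ht.2] with s hs
  rw [← S.potential_sub ⟨hs.1.le, hs.2.le⟩ hx]
  ring

theorem integral_velocity_potential {t : ℝ} (ht : t ∈ Icc (0:ℝ) T) :
    ∫ x in (0:ℝ)..1, (pdx S.u t x * S.potential t x + S.u t x * S.u t x) = 0 := by
  rw [intervalIntegral.integral_eq_sub_of_hasDerivAt (fun x _ =>
    (S.smooth_u.hasDerivAt_space t x).mul (S.hasDerivAt_potential_space t x))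
    ((((S.smooth_u.pdx.continuous_space t).mul (S.continuous_potential_space t)).add
      ((S.smooth_u.continuous_space t).mul (S.smooth_u.continuous_space t))).intervalIntegrable
        _ _)]
  simp [S.bc_u t ht]

theorem integral_pdx_u {t : ℝ} (ht : t ∈ Icc (0:ℝ) T) :
    ∫ x in (0:ℝ)..1, pdx S.u t x = 0 := by
  rw [intervalIntegral.integral_eq_sub_of_hasDerivAt
    (fun x _ => S.smooth_u.hasDerivAt_space t x)
    ((S.smooth_u.pdx.continuous_space t).intervalIntegrable _ _)]
  simp [S.bc_u t ht]

theorem integral_pdt_volume_potential {t : ℝ} (ht : t ∈ Icc (0:ℝ) T) :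
    ∫ x in (0:ℝ)..1, (pdx S.u t x * S.potential t x + S.v t x * (S.sigma t x - S.sigma t 0))
      = -(S.meanPressure t + S.sigma t 0) := by
  have hvc := S.smooth_v.continuous_space t
  have huc := S.smooth_u.continuous_space t
  have huxc := S.smooth_u.pdx.continuous_space t
  have hpc := S.smooth_pressureDensity.continuous_space t
  have h : ∀ x, pdx S.u t x * S.potential t x + S.v t x * (S.sigma t x - S.sigma t 0)
      = (pdx S.u t x * S.potential t x + S.u t x * S.u t x) + pdx S.u t x
        - S.pressureDensity t x - S.sigma t 0 * S.v t x := by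
    intro x
    have hs : S.sigma t x = pdx S.u t x / S.v t x - S.θ t x / S.v t x
      - (pdx S.χ t x / S.v t x) ^ 2 / 2 := rfl
    have hv := (S.v_pos t x).ne'
    rw [hs]
    unfold pressureDensity
    field_simp
    ring
  have h1 : Continuous (fun x => pdx S.u t x * S.potential t x + S.u t x * S.u t x) :=
    (huxc.mul (S.continuous_potential_space t)).add (huc.mul huc)
  simp_rw [h]
  have h2 : Continuous (fun x => pdx S.u t x * S.potential t x + S.u t x * S.u t x
    + pdx S.u t x) := h1.add huxc
  have h3 : Continuous (fun x => pdx S.u t x * S.potential t x + S.u t x * S.u t x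
    + pdx S.u t x - S.pressureDensity t x) := h2.sub hpc
  rw [intervalIntegral.integral_sub (h3.intervalIntegrable _ _)
      ((hvc.const_mul _).intervalIntegrable _ _),
    intervalIntegral.integral_sub (h2.intervalIntegrable _ _) (hpc.intervalIntegrable _ _),
    intervalIntegral.integral_add (h1.intervalIntegrable _ _) (huxc.intervalIntegrable _ _),
    S.integral_velocity_potential ht, S.integral_pdx_u ht, intervalIntegral.integral_const_mul,
    S.integral_v ht]
  unfold meanPressure
  ring

theorem meanPotential_sub {t : ℝ} (ht : t ∈ Icc (0:ℝ) T) :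
    S.meanPotential t - S.meanPotential 0
      = ∫ s in (0:ℝ)..t, -(S.meanPressure s + S.sigma s 0) := by
  have hsig0 : Continuous (fun p : ℝ × ℝ => S.sigma p.1 0) :=
    (S.smooth_sigma.continuous_time 0).comp continuous_fst
  have h := integral_space_sub_eq_of_hasDerivAt_time
    (F := fun t x => S.v t x * S.potential t x)
    (G := fun t x => pdx S.u t x * S.potential t x + S.v t x * (S.sigma t x - S.sigma t 0))
    (S.smooth_v.continuous.mul S.continuous_potential)
    ((S.smooth_u.pdx.continuous.mul S.continuous_potential).add
      (S.smooth_v.continuous.mul (S.smooth_sigma.continuous.sub hsig0))) ht.1 zero_le_one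
    (fun s hs x hx => by
      rw [← S.mass s ⟨hs.1.le, hs.2.le.trans ht.2⟩ x hx]
      exact (S.smooth_v.hasDerivAt_time s x).mul
        (S.hasDerivAt_potential_time ⟨hs.1, hs.2.trans_le ht.2⟩ hx))
  refine h.trans (intervalIntegral.integral_congr fun s hs => ?_)
  rw [uIcc_of_le ht.1] at hs
  exact S.integral_pdt_volume_potential ⟨hs.1, hs.2.trans ht.2⟩

/-- The bounded part of the representation of `log v`. -/
def driftTerm (x : ℝ) : ℝ → ℝ := fun t => Real.log (S.v 0 x)
  + (S.potential t x - S.potential 0 x) - (S.meanPotential t - S.meanPotential 0)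

theorem log_v_eq {t x : ℝ} (ht : t ∈ Icc (0:ℝ) T) (hx : x ∈ Icc (0:ℝ) 1) :
    Real.log (S.v t x) = S.driftTerm x t - (∫ s in (0:ℝ)..t, S.meanPressure s)
      + ∫ s in (0:ℝ)..t, S.source s x / S.v s x := by
  have hlog : ∫ s in (0:ℝ)..t, pdt S.v s x / S.v s x
      = Real.log (S.v t x) - Real.log (S.v 0 x) :=
    intervalIntegral.integral_eq_sub_of_hasDerivAt
      (fun s _ => (S.smooth_v.hasDerivAt_time s x).log (S.v_pos s x).ne')
      (((S.smooth_v.pdt.div S.smooth_v S.v_pos).continuous_time x).intervalIntegrable _ _)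
  have hsx := S.smooth_sigma.continuous_time x
  have hs0 := S.smooth_sigma.continuous_time 0
  have hP := S.continuous_meanPressure
  have hQ := (S.smooth_source.div S.smooth_v S.v_pos).continuous_time x
  have hdecomp : ∫ s in (0:ℝ)..t, pdt S.v s x / S.v s x
      = ∫ s in (0:ℝ)..t, ((S.sigma s x - S.sigma s 0) - -(S.meanPressure s + S.sigma s 0)
        - S.meanPressure s + S.source s x / S.v s x) := by
    apply intervalIntegral.integral_congr
    intro s hs
    rw [uIcc_of_le ht.1] at hs
    have hv := (S.v_pos s x).ne'
    simp only
    rw [S.mass s ⟨hs.1, hs.2.trans ht.2⟩ x hx]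
    unfold source sigma
    field_simp
    ring
  have h1 : Continuous (fun s => S.sigma s x - S.sigma s 0) := hsx.sub hs0
  have h2 : Continuous (fun s => -(S.meanPressure s + S.sigma s 0)) := (hP.add hs0).neg
  have h3 : Continuous (fun s => (S.sigma s x - S.sigma s 0)
    - -(S.meanPressure s + S.sigma s 0)) := h1.sub h2
  have h4 : Continuous (fun s => (S.sigma s x - S.sigma s 0)
    - -(S.meanPressure s + S.sigma s 0) - S.meanPressure s) := h3.sub hP
  rw [intervalIntegral.integral_add (h4.intervalIntegrable _ _) (hQ.intervalIntegrable _ _),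
    intervalIntegral.integral_sub (h3.intervalIntegrable _ _) (hP.intervalIntegrable _ _),
    intervalIntegral.integral_sub (h1.intervalIntegrable _ _) (h2.intervalIntegrable _ _),
    ← S.potential_sub ht hx, ← S.meanPotential_sub ht] at hdecomp
  unfold driftTerm
  linarith

theorem abs_potential_le {t x : ℝ} (ht : t ∈ Icc (0:ℝ) T) (hx : x ∈ Icc (0:ℝ) 1) :
    |S.potential t x| ≤ 3 / 2 := by
  have huc := S.smooth_u.continuous_space t
  have hsq : Continuous (fun y => S.u t y ^ 2 / 2) := (huc.pow 2).div_const 2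
  have hc : Continuous (fun y => 1 / 2 + S.u t y ^ 2 / 2) := continuous_const.add hsq
  calc |S.potential t x| ≤ ∫ y in (0:ℝ)..x, |S.u t y| :=
        intervalIntegral.abs_integral_le_integral_abs hx.1
    _ ≤ ∫ y in (0:ℝ)..1, |S.u t y| :=
        intervalIntegral_mono_interval_of_nonneg huc.abs le_rfl hx.1 hx.2
          fun _ _ => abs_nonneg _
    _ ≤ ∫ y in (0:ℝ)..1, (1 / 2 + S.u t y ^ 2 / 2) := by
        apply intervalIntegral.integral_mono_on zero_le_one (huc.abs.intervalIntegrable _ _)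
          (hc.intervalIntegrable _ _)
        intro y _
        nlinarith [sq_nonneg (|S.u t y| - 1), sq_abs (S.u t y)]
    _ = 1 / 2 + (∫ y in (0:ℝ)..1, S.u t y ^ 2) / 2 := by
        rw [intervalIntegral.integral_add (by simp) (hsq.intervalIntegrable _ _),
          intervalIntegral.integral_div]
        simp
    _ ≤ 3 / 2 := by linarith [S.integral_u_sq_le ht]

theorem abs_meanPotential_le {t : ℝ} (ht : t ∈ Icc (0:ℝ) T) : |S.meanPotential t| ≤ 3 / 2 := by
  have hvc := S.smooth_v.continuous_space t
  have hc : Continuous (fun x => S.v t x * S.potential t x) :=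
    hvc.mul (S.continuous_potential_space t)
  calc |S.meanPotential t| ≤ ∫ x in (0:ℝ)..1, |S.v t x * S.potential t x| :=
        intervalIntegral.abs_integral_le_integral_abs zero_le_one
    _ ≤ ∫ x in (0:ℝ)..1, 3 / 2 * S.v t x := by
        apply intervalIntegral.integral_mono_on zero_le_one (hc.abs.intervalIntegrable _ _)
          ((hvc.const_mul _).intervalIntegrable _ _)
        intro x hx
        have hv := S.v_pos t x
        rw [abs_mul, abs_of_pos hv, mul_comm]
        exact mul_le_mul_of_nonneg_right (S.abs_potential_le ht hx) hv.le
    _ = 3 / 2 := by rw [intervalIntegral.integral_const_mul, S.integral_v ht, mul_one]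

theorem abs_driftTerm_le {t x : ℝ} (ht : t ∈ Icc (0:ℝ) T) (hx : x ∈ Icc (0:ℝ) 1) :
    |S.driftTerm x t| ≤ |Real.log V₀| + |Real.log R| + 6 := by
  have h1 := abs_le.1 (S.abs_potential_le ht hx)
  have h2 := abs_le.1 (S.abs_potential_le S.zero_mem hx)
  have h3 := abs_le.1 (S.abs_meanPotential_le ht)
  have h4 := abs_le.1 (S.abs_meanPotential_le S.zero_mem)
  have h5 := Real.log_le_log S.V₀_pos (S.initial_v_ge x hx)
  have h6 := Real.log_le_log (S.v_pos 0 x) (S.initial_v_le x hx)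
  have h7 := neg_abs_le (Real.log V₀)
  have h8 := le_abs_self (Real.log R)
  have h9 := abs_nonneg (Real.log V₀)
  have h10 := abs_nonneg (Real.log R)
  unfold driftTerm
  rw [abs_le]
  constructor <;> linarith [h1.1, h1.2, h2.1, h2.2, h3.1, h3.2, h4.1, h4.2]

theorem meanPressure_ge {t : ℝ} (ht : t ∈ Icc (0:ℝ) T) : V₀ ^ 2 ≤ S.meanPressure t := by
  refine (S.integral_θ_ge ht).trans (intervalIntegral.integral_mono_on zero_le_one
    ((S.smooth_θ.continuous_space t).intervalIntegrable _ _)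
    ((S.smooth_pressureDensity.continuous_space t).intervalIntegrable _ _) fun x _ => ?_)
  obtain ⟨h1, -, h3⟩ := S.energy_terms_nonneg t x
  unfold pressureDensity
  linarith

theorem meanPressure_le {t : ℝ} (ht : t ∈ Icc (0:ℝ) T) : S.meanPressure t ≤ 2 := by
  have h : S.meanPressure t ≤ ∫ x in (0:ℝ)..1, 2 * S.energy t x := by
    apply intervalIntegral.integral_mono_on zero_le_one
      ((S.smooth_pressureDensity.continuous_space t).intervalIntegrable _ _)
      (((S.smooth_energy.continuous_space t).const_mul 2).intervalIntegrable _ _)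
    intro x _
    obtain ⟨h1, h2, h3⟩ := S.energy_terms_nonneg t x
    have := S.θ_pos t x
    unfold energy pressureDensity; linarith
  rw [intervalIntegral.integral_const_mul, S.integral_energy ht] at h
  linarith

theorem θ_le_source (t x : ℝ) : S.θ t x ≤ S.source t x := by
  have h := S.v_pos t x
  have : 0 ≤ S.v t x * (S.q t x) ^ 2 / 2 := by positivity
  unfold source; linarith

theorem source_nonneg (t x : ℝ) : 0 ≤ S.source t x := (S.θ_pos t x).le.trans (S.θ_le_source t x)

/-- Two-sided bounds for the specific volume in terms of the source. -/
theorem v_bounds_of_source {x : ℝ} (hx : x ∈ Icc (0:ℝ) 1) {K : ℝ}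
    (hK : |Real.log V₀| + |Real.log R| + 6 ≤ K) :
    ∀ t ∈ Icc 0 T, Real.exp (-K - 2 * t) ≤ S.v t x
      ∧ Real.exp (-2 * K) * (∫ s in (0:ℝ)..t, S.source s x * Real.exp (-2 * (t - s))) ≤ S.v t x
      ∧ S.v t x ≤ Real.exp (K - V₀ ^ 2 * t) + Real.exp (2 * K)
        * ∫ s in (0:ℝ)..t, S.source s x * Real.exp (-V₀ ^ 2 * (t - s)) := by
  have hP := S.continuous_meanPressure
  have hp : Continuous (fun t => ∫ s in (0:ℝ)..t, S.meanPressure s) :=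
    intervalIntegral.continuous_primitive (fun _ _ => hP.intervalIntegrable _ _) 0
  have hd : Continuous (S.driftTerm x) :=
    (continuous_const.add ((S.continuous_potential_time x).sub continuous_const)).sub
      (S.continuous_meanPotential.sub continuous_const)
  have hpsub : ∀ s t, (∫ r in (0:ℝ)..t, S.meanPressure r) - ∫ r in (0:ℝ)..s, S.meanPressure r
      = ∫ r in s..t, S.meanPressure r := fun s t =>
    intervalIntegral.integral_interval_sub_left (hP.intervalIntegrable _ _)
      (hP.intervalIntegrable _ _)
  refine bounds_of_log_eq (S.smooth_v.continuous_time x) hd hp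
    (S.smooth_source.continuous_time x) (fun t => S.v_pos t x)
    (fun t ht => S.log_v_eq ht hx) (fun t _ => S.source_nonneg t x)
    (fun t ht => (S.abs_driftTerm_le ht hx).trans hK) intervalIntegral.integral_same ?_ ?_
  · intro s t hs hst htT
    rw [hpsub]
    have := intervalIntegral.integral_mono_on (μ := volume) hst
      (continuous_const.intervalIntegrable s t) (hP.intervalIntegrable s t)
      (fun r hr => S.meanPressure_ge ⟨hs.trans hr.1, hr.2.trans htT⟩)
    rwa [intervalIntegral.integral_const, smul_eq_mul, mul_comm] at this
  · intro s t hs hst htT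
    rw [hpsub]
    have := intervalIntegral.integral_mono_on (μ := volume) hst
      (hP.intervalIntegrable s t) (continuous_const.intervalIntegrable s t)
      (fun r hr => S.meanPressure_le ⟨hs.trans hr.1, hr.2.trans htT⟩)
    rwa [intervalIntegral.integral_const, smul_eq_mul, mul_comm] at this

end RegularFlow

/-! ### Uniform bounds for the specific volume -/

/-- A bound for the bounded part of the representation of `log v`. -/
def driftBound (V₀ R : ℝ) : ℝ := |Real.log V₀| + |Real.log R| + 6

/-- A length of time over which the temperature is bounded below on average. -/
def relaxationTime (β V₀ : ℝ) : ℝ := 1 + -2 * Real.log V₀ / (V₀ ^ β / β) ^ 2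

/-- The lower bound for the specific volume. -/
def volumeLower (β V₀ R : ℝ) : ℝ :=
  min (Real.exp (-driftBound V₀ R - 2 * relaxationTime β V₀))
    (Real.exp (-2 * driftBound V₀ R)
      * (Real.exp (-2 * relaxationTime β V₀) * (V₀ ^ β / 2) ^ (2 / β)))

/-- The upper bound for the specific volume. -/
def volumeUpper (β V₀ R : ℝ) : ℝ :=
  (Real.exp (driftBound V₀ R) + Real.exp (2 * driftBound V₀ R) * (2 / V₀ ^ 2))
    * Real.exp (Real.exp (2 * driftBound V₀ R) * (1 / 2 + 2 / volumeLower β V₀ R)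
      * (-2 * Real.log V₀))

theorem volumeLower_pos {β V₀ R : ℝ} (hV₀ : 0 < V₀) : 0 < volumeLower β V₀ R :=
  lt_min (Real.exp_pos _) (by positivity)

theorem volumeUpper_pos {β V₀ R : ℝ} (hV₀ : 0 < V₀) : 0 < volumeUpper β V₀ R := by
  unfold volumeUpper; positivity

theorem integral_exp_neg_mul_le {c t : ℝ} (hc : 0 < c) :
    ∫ s in (0:ℝ)..t, 2 * Real.exp (-c * (t - s)) ≤ 2 / c := by
  have hd : ∀ s, HasDerivAt (fun s => 2 / c * Real.exp (-c * (t - s)))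
      (2 * Real.exp (-c * (t - s))) s := fun s => by
    have h := ((((hasDerivAt_id s).const_sub t).const_mul (-c)).exp).const_mul (2 / c)
    exact h.congr_deriv (by simp only [id]; field_simp)
  rw [intervalIntegral.integral_eq_sub_of_hasDerivAt (fun s _ => hd s)
    ((by fun_prop : Continuous fun s => 2 * Real.exp (-c * (t - s))).intervalIntegrable _ _)]
  have : 0 ≤ 2 / c * Real.exp (-c * (t - 0)) := by positivity
  simp only [sub_self, mul_zero, Real.exp_zero, mul_one]
  linarith

namespace RegularFlow

variable {β T V₀ R : ℝ} (S : RegularFlow β T V₀ R)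

/-- The uniform lower bound for the specific volume. -/
theorem volumeLower_le (hβ : 0 < β) {t x : ℝ} (ht : t ∈ Icc (0:ℝ) T) (hx : x ∈ Icc (0:ℝ) 1) :
    volumeLower β V₀ R ≤ S.v t x := by
  obtain ⟨h1, h2, -⟩ := S.v_bounds_of_source hx (K := driftBound V₀ R) le_rfl t ht
  have hV := S.V₀_pos
  set L := relaxationTime β V₀ with hL
  set c₁ := (V₀ ^ β / 2) ^ (2 / β) with hc₁
  set δ := (V₀ ^ β / β) ^ 2 with hδ
  have hδ0 : 0 < δ := by positivity
  have hc₁0 : 0 < c₁ := by positivity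
  have hL1 : 1 ≤ L := by
    have : 0 ≤ -2 * Real.log V₀ / δ := div_nonneg (by linarith [S.log_V₀_nonpos]) hδ0.le
    rw [hL]; unfold relaxationTime; linarith
  rcases le_total t L with htL | htL
  · refine (min_le_left _ _).trans (le_trans ?_ h1)
    exact Real.exp_le_exp.2 (by linarith)
  refine (min_le_right _ _).trans (le_trans ?_ h2)
  refine mul_le_mul_of_nonneg_left ?_ (Real.exp_pos _).le
  have hWc := S.continuous_W
  have hsrc : Continuous (fun s => S.source s x * Real.exp (-2 * (t - s))) :=
    (S.smooth_source.continuous_time x).mul (by fun_prop)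
  have hlow : Continuous (fun s => Real.exp (-2 * L) * (c₁ * (1 - S.W s / δ))) := by fun_prop
  have hwindow : ∫ s in (t - L)..t, Real.exp (-2 * L) * (c₁ * (1 - S.W s / δ))
      ≤ ∫ s in (t - L)..t, S.source s x * Real.exp (-2 * (t - s)) := by
    apply intervalIntegral.integral_mono_on (by linarith) (hlow.intervalIntegrable _ _)
      (hsrc.intervalIntegrable _ _)
    intro s hs
    have hs' : s ∈ Icc (0:ℝ) T := ⟨by linarith [hs.1], hs.2.trans ht.2⟩
    have h3 : c₁ * (1 - S.W s / δ) ≤ S.source s x :=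
      (S.θ_ge hβ hs' hx).trans (S.θ_le_source s x)
    have h4 : Real.exp (-2 * L) ≤ Real.exp (-2 * (t - s)) :=
      Real.exp_le_exp.2 (by linarith [hs.1])
    calc Real.exp (-2 * L) * (c₁ * (1 - S.W s / δ))
        ≤ Real.exp (-2 * L) * S.source s x :=
          mul_le_mul_of_nonneg_left h3 (Real.exp_pos _).le
      _ ≤ Real.exp (-2 * (t - s)) * S.source s x :=
          mul_le_mul_of_nonneg_right h4 (S.source_nonneg s x)
      _ = S.source s x * Real.exp (-2 * (t - s)) := mul_comm _ _
  have hall : ∫ s in (t - L)..t, S.source s x * Real.exp (-2 * (t - s))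
      ≤ ∫ s in (0:ℝ)..t, S.source s x * Real.exp (-2 * (t - s)) :=
    intervalIntegral_mono_interval_of_nonneg hsrc (by linarith) (by linarith) le_rfl
      fun s _ => mul_nonneg (S.source_nonneg s x) (Real.exp_pos _).le
  refine le_trans ?_ (hwindow.trans hall)
  rw [intervalIntegral.integral_const_mul, intervalIntegral.integral_const_mul,
    intervalIntegral.integral_sub (by simp) ((hWc.div_const δ).intervalIntegrable _ _),
    intervalIntegral.integral_div, intervalIntegral.integral_const, smul_eq_mul, mul_one,
    sub_sub_cancel]
  refine mul_le_mul_of_nonneg_left ?_ (Real.exp_pos _).le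
  have hW : ∫ s in (t - L)..t, S.W s ≤ -2 * Real.log V₀ :=
    (intervalIntegral_mono_interval_of_nonneg hWc (by linarith) (by linarith) le_rfl
      fun s _ => S.W_nonneg s).trans (S.integral_W_le ht)
  have hWδ : (∫ s in (t - L)..t, S.W s) / δ ≤ -2 * Real.log V₀ / δ :=
    div_le_div_of_nonneg_right hW hδ0.le
  have hLeq : L = 1 + -2 * Real.log V₀ / δ := rfl
  exact le_mul_of_one_le_right hc₁0.le (by linarith)

/-- The maximum of the specific volume over space. -/
def maxVolume : ℝ → ℝ := fun t => sSup (S.v t '' Icc 0 1)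

theorem continuous_maxVolume : Continuous S.maxVolume :=
  isCompact_Icc.continuous_sSup S.smooth_v.continuous

theorem v_le_maxVolume {t x : ℝ} (hx : x ∈ Icc (0:ℝ) 1) : S.v t x ≤ S.maxVolume t :=
  le_csSup (isCompact_Icc.image (S.smooth_v.continuous_space t)).bddAbove
    (mem_image_of_mem _ hx)

theorem maxVolume_le {t c : ℝ} (h : ∀ x ∈ Icc (0:ℝ) 1, S.v t x ≤ c) : S.maxVolume t ≤ c :=
  csSup_le ((nonempty_Icc.2 zero_le_one).image _) (forall_mem_image.2 h)

theorem maxVolume_pos (t : ℝ) : 0 < S.maxVolume t :=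
  (S.v_pos t 0).trans_le (S.v_le_maxVolume ⟨le_rfl, zero_le_one⟩)

theorem source_le (hβ : 0 < β) {t x : ℝ} (ht : t ∈ Icc (0:ℝ) T) (hx : x ∈ Icc (0:ℝ) 1) :
    S.source t x ≤ 2 + (1 / 2 + 2 / volumeLower β V₀ R) * S.W t * S.maxVolume t := by
  have hl : 0 < volumeLower β V₀ R := volumeLower_pos S.V₀_pos
  have h1 := S.θ_le hβ ht hx fun y hy => S.v_le_maxVolume hy
  have h2 := S.q_sq_le ht hx hl fun y hy => S.volumeLower_le hβ ht hy
  have h3 : S.v t x * S.q t x ^ 2 ≤ S.maxVolume t * (4 * S.W t / volumeLower β V₀ R) :=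
    mul_le_mul (S.v_le_maxVolume hx) h2 (sq_nonneg _) (S.maxVolume_pos t).le
  have h4 : S.maxVolume t * (4 * S.W t / volumeLower β V₀ R) / 2
      = 2 / volumeLower β V₀ R * S.W t * S.maxVolume t := by ring
  unfold source
  linarith

/-- The uniform upper bound for the specific volume. -/
theorem le_volumeUpper (hβ : 0 < β) {t x : ℝ} (ht : t ∈ Icc (0:ℝ) T) (hx : x ∈ Icc (0:ℝ) 1) :
    S.v t x ≤ volumeUpper β V₀ R := by
  have hV2 : 0 < V₀ ^ 2 := pow_pos S.V₀_pos 2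
  have hl : 0 < volumeLower β V₀ R := volumeLower_pos S.V₀_pos
  set K := driftBound V₀ R with hK
  set k := 1 / 2 + 2 / volumeLower β V₀ R with hk
  have hk0 : 0 < k := by positivity
  have hWc := S.continuous_W
  have hMc := S.continuous_maxVolume
  have hkc : Continuous (fun s => Real.exp (2 * K) * k * S.W s) := hWc.const_mul _
  have hineq : ∀ t ∈ Icc 0 T, S.maxVolume t
      ≤ (Real.exp K + Real.exp (2 * K) * (2 / V₀ ^ 2))
        + ∫ s in (0:ℝ)..t, Real.exp (2 * K) * k * S.W s * S.maxVolume s := by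
    intro t ht
    refine S.maxVolume_le fun x hx => ?_
    obtain ⟨-, -, h⟩ := S.v_bounds_of_source hx (K := K) le_rfl t ht
    have hexp : Continuous (fun s => 2 * Real.exp (-V₀ ^ 2 * (t - s))) := by fun_prop
    have hkWM : Continuous (fun s => k * S.W s * S.maxVolume s) := (hWc.const_mul k).mul hMc
    have hsum : Continuous (fun s => 2 * Real.exp (-V₀ ^ 2 * (t - s))
      + k * S.W s * S.maxVolume s) := hexp.add hkWM
    have hsrc : Continuous (fun s => S.source s x * Real.exp (-V₀ ^ 2 * (t - s))) :=
      (S.smooth_source.continuous_time x).mul (by fun_prop)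
    have hintegral : ∫ s in (0:ℝ)..t, S.source s x * Real.exp (-V₀ ^ 2 * (t - s))
        ≤ ∫ s in (0:ℝ)..t, (2 * Real.exp (-V₀ ^ 2 * (t - s)) + k * S.W s * S.maxVolume s) := by
      apply intervalIntegral.integral_mono_on ht.1 (hsrc.intervalIntegrable _ _)
        (hsum.intervalIntegrable _ _)
      intro s hs
      have h1 := S.source_le hβ ⟨hs.1, hs.2.trans ht.2⟩ hx
      rw [← hk] at h1
      have h2 : Real.exp (-V₀ ^ 2 * (t - s)) ≤ 1 :=
        Real.exp_le_one_iff.2 (by nlinarith [hs.2])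
      have h3 : 0 ≤ k * S.W s * S.maxVolume s :=
        mul_nonneg (mul_nonneg hk0.le (S.W_nonneg s)) (S.maxVolume_pos s).le
      have h4 := mul_le_mul_of_nonneg_right h1 (Real.exp_pos (-V₀ ^ 2 * (t - s))).le
      have h5 := mul_le_mul_of_nonneg_left h2 h3
      linarith
    rw [intervalIntegral.integral_add (hexp.intervalIntegrable _ _)
      (hkWM.intervalIntegrable _ _)] at hintegral
    have hconst : ∫ s in (0:ℝ)..t, Real.exp (2 * K) * k * S.W s * S.maxVolume s
        = Real.exp (2 * K) * ∫ s in (0:ℝ)..t, k * S.W s * S.maxVolume s := by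
      rw [← intervalIntegral.integral_const_mul]
      simp only [mul_assoc]
    have hdecay := integral_exp_neg_mul_le (t := t) hV2
    have hK0 : Real.exp (K - V₀ ^ 2 * t) ≤ Real.exp K :=
      Real.exp_le_exp.2 (by nlinarith [ht.1])
    have h6 := mul_le_mul_of_nonneg_left (hintegral.trans (add_le_add_left hdecay _))
      (Real.exp_pos (2 * K)).le
    rw [hconst]
    linarith
  have hgron := le_mul_exp_of_le_add_integral hMc hkc
    (fun s _ => mul_nonneg (by positivity) (S.W_nonneg s)) hineq t ht
  rw [intervalIntegral.integral_const_mul] at hgron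
  refine (S.v_le_maxVolume hx).trans (hgron.trans ?_)
  unfold volumeUpper
  refine mul_le_mul_of_nonneg_left (Real.exp_le_exp.2 ?_) (by positivity)
  exact mul_le_mul_of_nonneg_left (S.integral_W_le ht) (by positivity)

end RegularFlow

/-! ### Smooth positive extensions -/

/-- A smooth positive function on the line which is the identity on `[2c, ∞)`. -/
def positivePart (c s : ℝ) : ℝ := c + Real.smoothTransition ((s - c) / c) * (s - c)

theorem positivePart_pos {c : ℝ} (hc : 0 < c) (s : ℝ) : 0 < positivePart c s := by
  unfold positivePart
  rcases le_total s c with h | h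
  · rw [Real.smoothTransition.zero_of_nonpos (div_nonpos_of_nonpos_of_nonneg (by linarith) hc.le)]
    linarith
  · have := mul_nonneg (Real.smoothTransition.nonneg ((s - c) / c)) (sub_nonneg.2 h)
    linarith

theorem positivePart_eq_self {c s : ℝ} (hc : 0 < c) (hs : 2 * c ≤ s) : positivePart c s = s := by
  unfold positivePart
  rw [Real.smoothTransition.one_of_one_le (by rw [one_le_div hc]; linarith)]
  ring

theorem SmoothTX.positivePart {f : ℝ → ℝ → ℝ} (hf : SmoothTX f) (c : ℝ) :
    SmoothTX (fun t x => _root_.positivePart c (f t x)) := by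
  have h : ContDiff ℝ (⊤ : ℕ∞) (_root_.positivePart c) :=
    contDiff_const.add ((Real.smoothTransition.contDiff.comp
      ((contDiff_id.sub contDiff_const).div_const c)).mul (contDiff_id.sub contDiff_const))
  exact h.comp hf

/-- Two functions of time and space agree near a point. -/
def AgreeNear (f g : ℝ → ℝ → ℝ) (t x : ℝ) : Prop :=
  ∀ᶠ p : ℝ × ℝ in nhds (t, x), f p.1 p.2 = g p.1 p.2

namespace AgreeNear

variable {f g f₁ g₁ : ℝ → ℝ → ℝ} {t x : ℝ}

theorem eq (h : AgreeNear f g t x) : f t x = g t x := h.self_of_nhds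

theorem refl (f : ℝ → ℝ → ℝ) (t x : ℝ) : AgreeNear f f t x :=
  Filter.Eventually.of_forall fun _ => rfl

theorem map₂ (F : ℝ → ℝ → ℝ) (h : AgreeNear f g t x) (h₁ : AgreeNear f₁ g₁ t x) :
    AgreeNear (fun t x => F (f t x) (f₁ t x)) (fun t x => F (g t x) (g₁ t x)) t x := by
  filter_upwards [h, h₁] with p hp hp₁
  rw [hp, hp₁]

theorem pdx_eq (h : AgreeNear f g t x) : pdx f t x = pdx g t x :=
  Filter.EventuallyEq.deriv_eq ((Continuous.prodMk_right t).continuousAt.eventually h)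

theorem pdt_eq (h : AgreeNear f g t x) : pdt f t x = pdt g t x :=
  Filter.EventuallyEq.deriv_eq ((Continuous.prodMk_left x).continuousAt.eventually h)

theorem pdx (h : AgreeNear f g t x) : AgreeNear (pdx f) (pdx g) t x := by
  filter_upwards [h.eventually_nhds] with p hp using pdx_eq hp

theorem positivePart {m : ℝ} (hf : SmoothTX f) (hm : 0 < m) (h : m ≤ f t x) :
    AgreeNear (fun t x => _root_.positivePart (m / 4) (f t x)) f t x := by
  have hlt : m / 2 < f t x := by linarith
  filter_upwards [hf.continuous.continuousAt.eventually (lt_mem_nhds hlt)] with p hp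
  exact positivePart_eq_self (by linarith) (by linarith)

end AgreeNear

theorem L2sq_nonneg (g : ℝ → ℝ) : 0 ≤ L2sq g :=
  intervalIntegral.integral_nonneg zero_le_one fun _ _ => sq_nonneg _

theorem L2sq_deriv_le_H2sq (g : ℝ → ℝ) : L2sq (deriv g) ≤ H2sq g := by
  have h1 := L2sq_nonneg g
  have h2 := L2sq_nonneg (deriv (deriv g))
  unfold H2sq H1sq
  linarith

theorem H2sq_nonneg (g : ℝ → ℝ) : 0 ≤ H2sq g := (L2sq_nonneg _).trans (L2sq_deriv_le_H2sq g)

theorem InitData.L2sq_deriv_v_le {α β : ℝ} {I : Set ℝ} {sol : NSAC α β I} {V₀ M₀ : ℝ}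
    (h : InitData sol V₀ M₀) : L2sq (deriv (sol.v 0)) ≤ M₀ ^ 2 := by
  have h1 := h.2.2.2
  have h2 : Real.sqrt (H2sq (sol.v 0) + H2sq (sol.u 0) + H2sq (sol.θ 0)) ≤ M₀ := by
    linarith [Real.sqrt_nonneg (H3sq (sol.χ 0))]
  have h3 := (Real.sqrt_le_iff.1 h2).2
  linarith [L2sq_deriv_le_H2sq (sol.v 0), H2sq_nonneg (sol.u 0), H2sq_nonneg (sol.θ 0)]

theorem le_of_L2sq_deriv_le {f : ℝ → ℝ} (hf : ∀ x, HasDerivAt f (deriv f x) x)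
    (hf' : Continuous (deriv f)) (hintegral : ∫ x in (0:ℝ)..1, f x = 1) {B x : ℝ}
    (hB : L2sq (deriv f) ≤ B) (hx : x ∈ Icc (0:ℝ) 1) : f x ≤ 1 + (1 + B) / 2 := by
  have hcont : Continuous f := continuous_iff_continuousAt.2 fun x => (hf x).continuousAt
  obtain ⟨a, ha, hfa⟩ := exists_le_unit_integral hcont
  have h1 := (abs_le.1 (abs_sub_le_integral_abs_deriv_unit hf hf' ha hx)).2
  have hsq : Continuous (fun y => deriv f y ^ 2 / 2) := (hf'.pow 2).div_const 2
  have hsum : Continuous (fun y => 1 / 2 + deriv f y ^ 2 / 2) := continuous_const.add hsq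
  have h2 : ∫ y in (0:ℝ)..1, |deriv f y| ≤ ∫ y in (0:ℝ)..1, (1 / 2 + deriv f y ^ 2 / 2) := by
    apply intervalIntegral.integral_mono_on zero_le_one (hf'.abs.intervalIntegrable _ _)
      (hsum.intervalIntegrable _ _)
    intro y _
    nlinarith [sq_nonneg (|deriv f y| - 1), sq_abs (deriv f y)]
  rw [intervalIntegral.integral_add (by simp) (hsq.intervalIntegrable _ _),
    intervalIntegral.integral_const, sub_zero, one_smul, intervalIntegral.integral_div] at h2
  unfold L2sq at hB
  linarith

/-- A solution with constant viscosity gives rise to a regular flow. -/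
def XClass.toRegularFlow {β T m₁ m₂ m₃ N V₀ M₀ : ℝ} (sol : XClass 0 β T m₁ m₂ m₃ N)
    (hT : 0 < T) (hV₀ : 0 < V₀) (hinit : InitData sol.toNSAC V₀ M₀) :
    RegularFlow β T V₀ (1 + (1 + M₀ ^ 2) / 2) :=
  have hv : ∀ t ∈ Icc (0:ℝ) T, ∀ x ∈ Icc (0:ℝ) 1,
      AgreeNear (fun t x => positivePart (m₁ / 4) (sol.v t x)) sol.v t x :=
    fun t ht x hx => AgreeNear.positivePart sol.smooth_v sol.m₁pos (sol.lb_v t ht x hx)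
  have hθ : ∀ t ∈ Icc (0:ℝ) T, ∀ x ∈ Icc (0:ℝ) 1,
      AgreeNear (fun t x => positivePart (m₃ / 4) (sol.θ t x)) sol.θ t x :=
    fun t ht x hx => AgreeNear.positivePart sol.smooth_θ sol.m₃pos (sol.lb_θ t ht x hx)
  have hvsm : SmoothTX (fun t x => positivePart (m₁ / 4) (sol.v t x)) :=
    SmoothTX.positivePart sol.smooth_v (m₁ / 4)
  have hθsm : SmoothTX (fun t x => positivePart (m₃ / 4) (sol.θ t x)) :=
    SmoothTX.positivePart sol.smooth_θ (m₃ / 4)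
  have husm : SmoothTX sol.u := sol.smooth_u
  have hχsm : SmoothTX sol.χ := sol.smooth_χ
  have hvpos : ∀ t x, 0 < positivePart (m₁ / 4) (sol.v t x) :=
    fun t x => positivePart_pos (by linarith [sol.m₁pos]) _
  have h0 : (0:ℝ) ∈ Icc (0:ℝ) T := ⟨le_rfl, hT.le⟩
  have hq : ∀ t ∈ Icc (0:ℝ) T, ∀ x ∈ Icc (0:ℝ) 1,
      pdx (fun t x => pdx sol.χ t x / positivePart (m₁ / 4) (sol.v t x)) t x
        = pdx (fun t x => pdx sol.χ t x / sol.v t x) t x :=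
    fun t ht x hx => ((AgreeNear.refl (pdx sol.χ) t x).map₂ (· / ·) (hv t ht x hx)).pdx_eq
  { v := fun t x => positivePart (m₁ / 4) (sol.v t x)
    u := sol.u
    χ := sol.χ
    θ := fun t x => positivePart (m₃ / 4) (sol.θ t x)
    smooth_v := hvsm
    smooth_u := husm
    smooth_χ := hχsm
    smooth_θ := hθsm
    v_pos := hvpos
    θ_pos := fun t x => positivePart_pos (by linarith [sol.m₃pos]) _
    χ_pos := fun t ht x hx => sol.m₂pos.trans_le (sol.lb_χ t ht x hx)
    mass := fun t ht x hx => (hv t ht x hx).pdt_eq.trans (sol.eq_mass t ht x hx)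
    momentum := fun t ht x hx => by
      have h := sol.eq_mom t ht x hx
      simp only [Real.rpow_zero, one_mul] at h
      rw [← ((hθ t ht x hx).map₂ (· / ·) (hv t ht x hx)).pdx_eq,
        ← ((AgreeNear.refl (pdx sol.u) t x).map₂ (· / ·) (hv t ht x hx)).pdx_eq,
        ← ((AgreeNear.refl (pdx sol.χ) t x).map₂ (fun a b => a ^ 2 / b ^ 2)
          (hv t ht x hx)).pdx_eq] at h
      have h1 := (husm.pdx.div hvsm hvpos).hasDerivAt_space t x
      have h2 := (hθsm.div hvsm hvpos).hasDerivAt_space t x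
      have h3 := ((hχsm.pdx.pow 2).div (hvsm.pow 2)
        fun t x => pow_pos (hvpos t x) 2).hasDerivAt_space t x
      have h4 := ((h1.sub h2).sub (h3.const_mul (1 / 2))).deriv
      have h5 : (fun t x => pdx sol.u t x / positivePart (m₁ / 4) (sol.v t x)
          - positivePart (m₃ / 4) (sol.θ t x) / positivePart (m₁ / 4) (sol.v t x)
          - (pdx sol.χ t x / positivePart (m₁ / 4) (sol.v t x)) ^ 2 / 2)
          = fun t x => pdx sol.u t x / positivePart (m₁ / 4) (sol.v t x)
          - positivePart (m₃ / 4) (sol.θ t x) / positivePart (m₁ / 4) (sol.v t x)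
          - 1 / 2 * (pdx sol.χ t x ^ 2 / positivePart (m₁ / 4) (sol.v t x) ^ 2) := by
        funext t x; ring
      rw [h5]
      refine Eq.trans ?_ h4.symm
      linear_combination h
    phase := fun t ht x hx => by
      rw [hq t ht x hx, (hv t ht x hx).eq, ← sol.eq_mu t ht x hx]
      exact sol.eq_phase t ht x hx
    temperature := fun t ht x hx => by
      have h := sol.eq_temp t ht x hx
      simp only [Real.rpow_zero, one_mul] at h
      have hflux : AgreeNear (fun t x => positivePart (m₃ / 4) (sol.θ t x) ^ β
          * pdx (fun t x => positivePart (m₃ / 4) (sol.θ t x)) t x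
          / positivePart (m₁ / 4) (sol.v t x))
          (fun t x => sol.θ t x ^ β * pdx sol.θ t x / sol.v t x) t x :=
        ((hθ t ht x hx).map₂ (fun a b => a ^ β * b) (hθ t ht x hx).pdx).map₂ (· / ·)
          (hv t ht x hx)
      rw [hflux.pdx_eq, hq t ht x hx, (hv t ht x hx).eq, (hθ t ht x hx).eq,
        (hθ t ht x hx).pdt_eq, ← sol.eq_mu t ht x hx]
      exact h
    bc_u := sol.bc_u
    bc_χ := sol.bc_χ
    bc_θ := fun t ht => by
      rw [(hθ t ht 0 ⟨le_rfl, zero_le_one⟩).pdx_eq, (hθ t ht 1 ⟨zero_le_one, le_rfl⟩).pdx_eq]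
      exact sol.bc_θ t ht
    T_nonneg := hT.le
    V₀_pos := hV₀
    initial_volume := by
      refine Eq.trans (intervalIntegral.integral_congr fun x hx => ?_) sol.norm_v0
      rw [uIcc_of_le zero_le_one] at hx
      exact (hv 0 h0 x hx).eq
    initial_energy := by
      refine Eq.trans (intervalIntegral.integral_congr fun x hx => ?_) sol.norm_e0
      rw [uIcc_of_le zero_le_one] at hx
      simp only [(hv 0 h0 x hx).eq, (hθ 0 h0 x hx).eq]
    initial_v_ge := fun x hx => (hinit.1 x hx).trans_eq (hv 0 h0 x hx).eq.symm
    initial_v_le := fun x hx => (hv 0 h0 x hx).eq.trans_le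
      (le_of_L2sq_deriv_le (fun y => SmoothTX.hasDerivAt_space sol.smooth_v 0 y)
        ((SmoothTX.pdx sol.smooth_v).continuous_space 0) sol.norm_v0 hinit.L2sq_deriv_v_le hx)
    initial_χ_le := fun x hx => (hinit.2.1 x hx).2
    initial_θ_ge := fun x hx => (hinit.2.2.1 x hx).trans_eq (hθ 0 h0 x hx).eq.symm }

theorem XClass.toRegularFlow_v {β T m₁ m₂ m₃ N V₀ M₀ : ℝ} (sol : XClass 0 β T m₁ m₂ m₃ N)
    (hT : 0 < T) (hV₀ : 0 < V₀) (hinit : InitData sol.toNSAC V₀ M₀) {t x : ℝ}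
    (ht : t ∈ Icc (0:ℝ) T) (hx : x ∈ Icc (0:ℝ) 1) :
    (sol.toRegularFlow hT hV₀ hinit).v t x = sol.v t x :=
  (AgreeNear.positivePart sol.smooth_v sol.m₁pos (sol.lb_v t ht x hx)).eq

theorem eq_zero_of_rpow_le_one {a α : ℝ} (ha : 1 < a) (hα : 0 ≤ α) (h : a ^ α ≤ 1) : α = 0 := by
  rcases hα.eq_or_lt with h0 | hpos
  · exact h0.symm
  · exact absurd h (Real.one_lt_rpow ha hpos).not_ge

/-- Lemma 2.3 (uniform upper and lower bounds for the specific volume). -/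
theorem stmt_5 (β V₀ M₀ : ℝ) (hβ : 0 < β) (hV₀ : 0 < V₀) (hM₀ : 0 < M₀) :
    ∃ C₀ > (0:ℝ), ∃ ε₁ > (0:ℝ),
      ∀ (α T m₁ m₂ m₃ N : ℝ), 0 ≤ α → 0 < T →
        m₁ ≤ 1 → m₂ ≤ 1 → m₃ ≤ 1 → 8 ≤ N →
        ∀ sol : XClass α β T m₁ m₂ m₃ N,
        InitData sol.toNSAC V₀ M₀ →
        m₂ ^ (-α) ≤ 2 → (2 * N) ^ α ≤ 1 → α * Hq m₁ m₂ m₃ N ≤ ε₁ →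
        ∀ t ∈ Icc (0:ℝ) T, ∀ x ∈ Icc (0:ℝ) 1,
          C₀ ≤ sol.toNSAC.v t x ∧ sol.toNSAC.v t x ≤ C₀⁻¹ := by
  refine ⟨min (volumeLower β V₀ (1 + (1 + M₀ ^ 2) / 2))
      (volumeUpper β V₀ (1 + (1 + M₀ ^ 2) / 2))⁻¹,
    lt_min (volumeLower_pos hV₀) (inv_pos.2 (volumeUpper_pos hV₀)), 1, one_pos, ?_⟩
  intro α T m₁ m₂ m₃ N hα hT _ _ _ hN sol hinit _ hNα _ t ht x hx
  obtain rfl : α = 0 := eq_zero_of_rpow_le_one (by linarith) hα hNα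
  have hlow := (sol.toRegularFlow hT hV₀ hinit).volumeLower_le hβ ht hx
  have hupp := (sol.toRegularFlow hT hV₀ hinit).le_volumeUpper hβ ht hx
  rw [sol.toRegularFlow_v hT hV₀ hinit ht hx] at hlow hupp
  refine ⟨(min_le_left _ _).trans hlow, hupp.trans ?_⟩
  rw [le_inv_comm₀ (volumeUpper_pos hV₀)
    (lt_min (volumeLower_pos hV₀) (inv_pos.2 (volumeUpper_pos hV₀)))]
  exact min_le_right _ _

end
end
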